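/- arXiv:1808.04001 — 2 statements merged into one kernel-verified Lean document; each statement's English description precedes it below -/
import Mathlib

section
/- Let q be a power of 3 and fix a monic irreducible P ∈ F_q[T]. Then for every ε > 0 there exists N such that for every positive integer n and every X a power of q with X/|P|^n ≥ N, one has | Σ_{f monic, |f| ≤ X, f ≡ 1 mod P^n} μ(f) | ≤ ε·X/|P|^n. -/
open scoped Classical
open Polynomial Filter

/-- The norm `|f| = q ^ deg f` of a polynomial over `F_q`, with `|0| = 0`. -/
noncomputable def pnorm {Fq : Type} [Field Fq] [Fintype Fq] (f : Polynomial Fq) : ℝ :=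
  if f = 0 then 0 else (Fintype.card Fq : ℝ) ^ f.natDegree

/-- The Möbius function of a polynomial: `0` unless `f` is squarefree (in particular `μ 0 = 0`),
and `(-1)^k` for squarefree `f` with `k` distinct monic irreducible factors. -/
noncomputable def pmu {Fq : Type} [Field Fq] (f : Polynomial Fq) : ℤ :=
  if Squarefree f then (-1 : ℤ) ^ Multiset.card (UniqueFactorizationMonoid.normalizedFactors f)
  else 0

set_option linter.unusedSectionVars false
set_option linter.unusedVariables false


section Weil
variable {F : Type} [Field F] [Fintype F]

noncomputable def toP (B : ℕ) (v : Fin B → F) : F[X] := ((degreeLTEquiv F B).symm v : F[X])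

lemma toP_degree (B : ℕ) (v : Fin B → F) : (toP B v).degree < B :=
  mem_degreeLT.1 ((degreeLTEquiv F B).symm v).2

lemma toP_natDegree (B : ℕ) (hB : 0 < B) (v : Fin B → F) : (toP B v).natDegree < B := by
  rcases eq_or_ne (toP B v) 0 with h | h
  · simp [h, hB]
  · exact (natDegree_lt_iff_degree_lt h).2 (toP_degree B v)

lemma toP_inj (B : ℕ) : Function.Injective (toP (F := F) B) := by
  intro v w h
  exact (degreeLTEquiv F B).symm.injective (Subtype.ext h)

lemma toP_surj (B : ℕ) (f : F[X]) (hf : f.degree < B) : ∃ v, toP B v = f := by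
  refine ⟨degreeLTEquiv F B ⟨f, mem_degreeLT.2 hf⟩, ?_⟩
  simp [toP]

lemma nonvanish (h : F[X]) (hns : ∀ p r : F[X], ∀ c : F, p ≠ 0 → p ^ 2 * h ≠ C c * r ^ 2)
    (h0 : h.eval 0 ≠ 0) (D c : ℕ) (hD : h.natDegree ≤ D) [CharP F 3] (B J : ℕ)
    (hB : 2 * B + D ≤ 3 ^ c) (hBp : 0 < B)
    (p r : ℕ → F[X]) (hp : ∀ j, (p j).natDegree < B) (hr : ∀ j, (r j).natDegree < B)
    (hG : ∑ j ∈ Finset.range J, (p j + r j * h ^ ((3 ^ c - 1) / 2)) * X ^ (j * 3 ^ c) = 0) :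
    ∀ j < J, p j = 0 ∧ r j = 0 := by
  have : Fact (Nat.Prime 3) := ⟨by norm_num⟩
  have hhne : h ≠ 0 := by rintro rfl; simp at h0
  set k := 3 ^ c with hk
  have hkodd : 2 * ((k - 1) / 2) + 1 = k := by
    have : Odd k := Odd.pow (by decide)
    obtain ⟨m, hm⟩ := this
    omega
  have key : ∀ a b : F[X], a.natDegree < B → b.natDegree < B →
      X ^ k ∣ a + b * h ^ ((k - 1) / 2) → a = 0 ∧ b = 0 := by
    intro a b ha hb hdvd
    have h1 : X ^ k ∣ a ^ 2 * h - b ^ 2 * h ^ k := by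
      have : a ^ 2 * h - b ^ 2 * h ^ k =
          (a + b * h ^ ((k - 1) / 2)) * ((a - b * h ^ ((k - 1) / 2)) * h) := by
        conv_lhs => rw [← hkodd]
        ring
      rw [this]; exact hdvd.mul_right _
    have h2 : X ^ k ∣ h ^ k - C ((h.eval 0) ^ k) := by
      have : h ^ k - C ((h.eval 0) ^ k) = (h - C (h.eval 0)) ^ k := by
        rw [hk, sub_pow_char_pow, C_pow]
      rw [this]
      apply pow_dvd_pow_of_dvd
      have := X_sub_C_dvd_sub_C_eval (p := h) (a := 0)
      simpa using this
    have h3 : X ^ k ∣ a ^ 2 * h - b ^ 2 * C ((h.eval 0) ^ k) := by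
      have := dvd_add h1 (h2.mul_left (b ^ 2))
      convert this using 1; ring
    have h4 : a ^ 2 * h - b ^ 2 * C ((h.eval 0) ^ k) = 0 := by
      by_contra hne
      have := natDegree_le_of_dvd h3 hne
      have e1 : (a ^ 2 * h).natDegree < k := by
        have := natDegree_mul_le (p := a ^ 2) (q := h)
        have := natDegree_pow_le (p := a) (n := 2)
        omega
      have e2 : (b ^ 2 * C ((h.eval 0) ^ k)).natDegree < k := by
        have := natDegree_mul_le (p := b ^ 2) (q := C ((h.eval 0) ^ k))
        have := natDegree_pow_le (p := b) (n := 2)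
        rw [natDegree_C] at *
        omega
      have := natDegree_sub_le (a ^ 2 * h) (b ^ 2 * C ((h.eval 0) ^ k))
      rw [natDegree_X_pow] at *
      omega
    have ha0 : a = 0 := by
      by_contra hne
      apply hns a b ((h.eval 0) ^ k) hne
      rw [sub_eq_zero] at h4
      rw [h4]; ring
    refine ⟨ha0, ?_⟩
    subst ha0
    have : b ^ 2 * C ((h.eval 0) ^ k) = 0 := by simpa using h4
    rcases mul_eq_zero.1 this with h | h
    · exact pow_eq_zero_iff (two_ne_zero) |>.1 h
    · exfalso; rw [C_eq_zero] at h; exact h0 (pow_eq_zero_iff (by positivity) |>.1 h)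
  intro j
  induction j using Nat.strong_induction_on with
  | _ j ih =>
    intro hj
    apply key _ _ (hp j) (hr j)
    have hX : (X : F[X]) ^ (j * k) ≠ 0 := pow_ne_zero _ X_ne_zero
    rw [← mul_dvd_mul_iff_right hX, ← pow_add]
    have hsplit := Finset.sum_erase_add (Finset.range J)
      (fun j => (p j + r j * h ^ ((k - 1) / 2)) * X ^ (j * k)) (Finset.mem_range.2 hj)
    rw [hG] at hsplit
    rw [eq_neg_of_add_eq_zero_right hsplit]
    apply (dvd_neg).2
    apply Finset.dvd_sum
    intro i hi
    rcases lt_trichotomy i j with h | h | h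
    · obtain ⟨e1, e2⟩ := ih i h (h.trans hj)
      simp [e1, e2]
    · simp [h] at hi
    · apply Dvd.dvd.mul_left
      apply pow_dvd_pow
      nlinarith

lemma weil_count (h : F[X]) (hns : ∀ p r : F[X], ∀ c : F, p ≠ 0 → p ^ 2 * h ≠ C c * r ^ 2)
    (h0 : h.eval 0 ≠ 0) (D b c : ℕ) (hD : h.natDegree ≤ D) [CharP F 3]
    (hQ : Fintype.card F = 3 ^ (b + c)) (hbc : b ≤ c) (hbig : 8 * D + 12 ≤ 3 ^ c) (ω : F)
    (S : Finset F) (hS : ∀ x ∈ S, h.eval x ^ ((3 ^ (b + c) - 1) / 2) = ω) (hS0 : ∀ x ∈ S, h.eval x ≠ 0) :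
    2 * S.card ≤ 3 ^ (b + c) + (6 * D + 6) * 3 ^ c := by
  have : Fact (Nat.Prime 3) := ⟨by norm_num⟩
  set k := 3 ^ c with hk
  set l := 3 ^ b with hl
  have hlk : l ≤ k := Nat.pow_le_pow_right (by norm_num) hbc
  have hlodd : 2 * ((l - 1) / 2) + 1 = l := by
    obtain ⟨m, hm⟩ : Odd l := Odd.pow (by decide)
    omega
  have hkodd : 2 * ((k - 1) / 2) + 1 = k := by
    obtain ⟨m, hm⟩ : Odd k := Odd.pow (by decide)
    omega
  have hQk : 3 ^ (b + c) = l * k := by rw [pow_add]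
  set l2 := (l - 1) / 2
  set k2 := (k - 1) / 2
  have hexp : (3 ^ (b + c) - 1) / 2 = k2 * l + l2 := by
    rw [hQk, ← hkodd]
    have : l * (2 * k2 + 1) = 2 * (k2 * l) + l := by ring
    omega
  set B := (k - D) / 2 with hBdef
  have hB1 : 2 * B + D ≤ k := by omega
  have hB2 : k ≤ 4 * B := by omega
  have hBp : 0 < B := by omega
  set J := l2 + 1 + (2 * D + 2) with hJ
  set n := l * B + D * l2 + J with hn
  let Φ : (Fin J → (Fin B → F) × (Fin B → F)) → F[X] := fun v =>
    ∑ j : Fin J, (toP B (v j).1 ^ l * h ^ l2 + C ω * toP B (v j).2 ^ l) * X ^ (j : ℕ)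
  have hΦdeg : ∀ v, (Φ v).degree < n := by
    intro v
    refine lt_of_le_of_lt (degree_sum_le _ _) ?_
    rw [Finset.sup_lt_iff (by exact WithBot.bot_lt_coe n)]
    intro j _
    refine lt_of_le_of_lt (degree_le_natDegree) ?_
    norm_cast
    have h1 := toP_natDegree B hBp (v j).1
    have h2 := toP_natDegree B hBp (v j).2
    have hj := j.2
    have e1 : (toP B (v j).1 ^ l * h ^ l2).natDegree ≤ l * (B - 1) + l2 * D := by
      refine natDegree_mul_le.trans (add_le_add ?_ ?_)
      · refine natDegree_pow_le.trans (Nat.mul_le_mul_left _ (by omega))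
      · refine natDegree_pow_le.trans (Nat.mul_le_mul_left _ hD)
    have e2 : (C ω * toP B (v j).2 ^ l).natDegree ≤ l * (B - 1) + l2 * D := by
      refine natDegree_C_mul_le _ _ |>.trans ?_
      refine natDegree_pow_le.trans ?_
      refine le_trans (Nat.mul_le_mul_left _ (by omega : _ ≤ B - 1)) (Nat.le_add_right _ _)
    have e3 := natDegree_add_le_of_degree_le e1 e2
    refine lt_of_le_of_lt (natDegree_mul_le) ?_
    rw [natDegree_X_pow]
    have : l * B = l * (B - 1) + l := by
      obtain ⟨B', hB'⟩ : ∃ B', B = B' + 1 := ⟨B - 1, by omega⟩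
      rw [hB']; simp; ring
    have : D * l2 = l2 * D := mul_comm _ _
    omega
  let Ψ : (Fin J → (Fin B → F) × (Fin B → F)) → (Fin n → F) := fun v i => (Φ v).coeff i
  have hcard : Fintype.card (Fin n → F) < Fintype.card (Fin J → (Fin B → F) × (Fin B → F)) := by
    simp only [Fintype.card_fun, Fintype.card_prod, Fintype.card_fin]
    rw [← pow_add, ← pow_mul]
    apply Nat.pow_lt_pow_right Fintype.one_lt_card
    -- n < 2 B J
    have : 2 * J = l + 1 + 2 * (2 * D + 2) := by omega
    have e : (B + B) * J = (l + 1 + 2 * (2 * D + 2)) * B := by rw [← this]; ring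
    rw [e, hn]
    have : D * l2 ≤ D * l := Nat.mul_le_mul_left _ (by omega)
    have : J ≤ l + 2 * D + 2 := by omega
    nlinarith [Nat.mul_le_mul_left (D + 1) (hlk.trans hB2)]
  obtain ⟨v, w, hvw, hΨ⟩ := Fintype.exists_ne_map_eq_of_card_lt Ψ hcard
  have hΦ : Φ v = Φ w := by
    ext i
    by_cases hi : i < n
    · exact congrFun hΨ ⟨i, hi⟩
    · rw [coeff_eq_zero_of_degree_lt, coeff_eq_zero_of_degree_lt]
      · exact (hΦdeg w).trans_le (by exact_mod_cast not_lt.1 hi)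
      · exact (hΦdeg v).trans_le (by exact_mod_cast not_lt.1 hi)
  let p : ℕ → F[X] := fun j => if hj : j < J then toP B (v ⟨j, hj⟩).1 - toP B (w ⟨j, hj⟩).1 else 0
  let r : ℕ → F[X] := fun j => if hj : j < J then toP B (v ⟨j, hj⟩).2 - toP B (w ⟨j, hj⟩).2 else 0
  have hp : ∀ j, (p j).natDegree < B := by
    intro j; simp only [p]; split_ifs
    · refine lt_of_le_of_lt (natDegree_sub_le _ _) (max_lt (toP_natDegree B hBp _) (toP_natDegree B hBp _))
    · simpa
  have hr : ∀ j, (r j).natDegree < B := by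
    intro j; simp only [r]; split_ifs
    · refine lt_of_le_of_lt (natDegree_sub_le _ _) (max_lt (toP_natDegree B hBp _) (toP_natDegree B hBp _))
    · simpa
  set G := ∑ j ∈ Finset.range J, (p j + r j * h ^ k2) * X ^ (j * k) with hGdef
  have hR : ∑ j ∈ Finset.range J, (p j ^ l * h ^ l2 + C ω * r j ^ l) * X ^ j = 0 := by
    have := sub_eq_zero.2 hΦ
    simp only [Φ] at this
    rw [← Finset.sum_sub_distrib] at this
    rw [Finset.sum_range, ← this]
    apply Finset.sum_congr rfl
    intro j _
    simp only [p, r, j.2, dif_pos, hl, sub_pow_char_pow]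
    ring
  have hGne : G ≠ 0 := by
    intro hG
    have := nonvanish h hns h0 D c hD B J hB1 hBp p r hp hr hG
    apply hvw
    funext j
    obtain ⟨e1, e2⟩ := this j j.2
    simp only [p, r, j.2, dif_pos, sub_eq_zero] at e1 e2
    exact Prod.ext (toP_inj B e1) (toP_inj B e2)
  have hroot : ∀ x ∈ S, G.IsRoot x := by
    intro x hx
    have h1 := hS x hx
    have hxQ : x ^ (l * k) = x := by rw [← hQk, ← hQ]; exact FiniteField.pow_card x
    have : G.eval x ^ l * h.eval x ^ l2 = 0 := by
      rw [hGdef, eval_finsetSum, hl, sum_pow_char_pow, Finset.sum_mul]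
      have h2 := congrArg (eval x) hR
      rw [eval_finsetSum, eval_zero] at h2
      rw [← h2]
      apply Finset.sum_congr rfl
      intro j _
      simp only [eval_mul, eval_add, eval_pow, eval_X, eval_C]
      rw [mul_pow, add_pow_char_pow, mul_pow, ← hl, ← h1, hexp]
      have : (x ^ (j * k)) ^ l = x ^ j := by
        rw [← pow_mul, mul_assoc, mul_comm j, mul_comm k, pow_mul, hxQ]
      rw [this]
      ring
    rcases mul_eq_zero.1 this with h | h
    · exact pow_eq_zero_iff (by positivity) |>.1 h
    · exact absurd h (pow_ne_zero _ (hS0 x hx))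
  have hcardG : S.card ≤ G.natDegree := by
    refine le_trans ?_ (card_roots' G)
    refine le_trans ?_ (Multiset.toFinset_card_le _)
    apply Finset.card_le_card
    intro x hx
    rw [Multiset.mem_toFinset, mem_roots hGne]
    exact hroot x hx
  have hdegG : G.natDegree ≤ B + k2 * D + (J - 1) * k := by
    apply natDegree_sum_le_of_forall_le
    intro j hj
    have hj := Finset.mem_range.1 hj
    refine natDegree_mul_le.trans (add_le_add ?_ ?_)
    · refine (natDegree_add_le _ _).trans (max_le ?_ ?_)
      · have := hp j; omega
      · refine natDegree_mul_le.trans (add_le_add (hr j).le ?_)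
        exact natDegree_pow_le.trans (Nat.mul_le_mul_left _ hD)
    · rw [natDegree_X_pow]
      exact Nat.mul_le_mul_right _ (by omega)
  have hJ1 : J - 1 = l2 + (2 * D + 2) := by omega
  rw [hJ1] at hdegG
  rw [hQk]
  have : 2 * (k2 * D) + D = k * D := by rw [← hkodd]; ring
  have : l * k = 2 * (l2 * k) + k := by conv_lhs => rw [← hlodd]
                                        ring
  nlinarith


lemma weil_zero (h : F[X]) (hns : ∀ p r : F[X], ∀ c : F, p ≠ 0 → p ^ 2 * h ≠ C c * r ^ 2)
    (h0 : h.eval 0 ≠ 0) (D b c : ℕ) (hD : h.natDegree ≤ D) [CharP F 3]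
    (hQ : Fintype.card F = 3 ^ (b + c)) (hbc : b ≤ c) (hbig : 8 * D + 12 ≤ 3 ^ c) :
    |∑ x : F, quadraticChar F (h.eval x)| ≤ (8 * D + 12) * 3 ^ c := by
  have hne : h ≠ 0 := by rintro rfl; simp at h0
  have hchar : ringChar F ≠ 2 := by rw [ringChar.eq F 3]; norm_num
  have hcases : ∀ a : F, quadraticChar F a = 0 ∨ quadraticChar F a = 1 ∨ quadraticChar F a = -1 := by
    intro a
    by_cases ha : a = 0
    · simp [ha]
    · right; exact quadraticChar_dichotomy ha
  set S1 := Finset.univ.filter (fun x => quadraticChar F (h.eval x) = 1)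
  set S2 := Finset.univ.filter (fun x => quadraticChar F (h.eval x) = -1)
  set S0 := Finset.univ.filter (fun x => quadraticChar F (h.eval x) = 0)
  have hsum : ∑ x : F, quadraticChar F (h.eval x) = (S1.card : ℤ) - S2.card := by
    simp only [S1, S2, Finset.card_filter]
    push_cast
    rw [← Finset.sum_sub_distrib]
    apply Finset.sum_congr rfl
    intro x _
    rcases hcases (h.eval x) with e | e | e <;> simp [e]
  have htot : S1.card + S2.card + S0.card = Fintype.card F := by
    simp only [S1, S2, S0, Finset.card_filter, ← Finset.sum_add_distrib]
    rw [← Finset.card_univ, Finset.card_eq_sum_ones]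
    apply Finset.sum_congr rfl
    intro x _
    rcases hcases (h.eval x) with e | e | e <;> simp [e]
  have hS0 : S0.card ≤ D := by
    refine le_trans ?_ ((card_roots' h).trans hD)
    refine le_trans ?_ (Multiset.toFinset_card_le _)
    apply Finset.card_le_card
    intro x hx
    simp only [S0, Finset.mem_filter, quadraticChar_eq_zero_iff] at hx
    rw [Multiset.mem_toFinset, mem_roots hne]
    exact hx.2
  have hdiv : Fintype.card F / 2 = (3 ^ (b + c) - 1) / 2 := by
    rw [hQ]
    obtain ⟨m, hm⟩ : Odd (3 ^ (b + c)) := Odd.pow (by decide)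
    omega
  have h1 := weil_count h hns h0 D b c hD hQ hbc hbig 1 S1 (by
    intro x hx
    have hx := (Finset.mem_filter.1 hx).2
    have := quadraticChar_eq_pow_of_char_ne_two' hchar (h.eval x)
    rw [hx] at this
    rw [← hdiv, ← this]; simp) (by
    intro x hx h0
    have hx := (Finset.mem_filter.1 hx).2
    simp [h0] at hx)
  have h2 := weil_count h hns h0 D b c hD hQ hbc hbig (-1) S2 (by
    intro x hx
    have hx := (Finset.mem_filter.1 hx).2
    have := quadraticChar_eq_pow_of_char_ne_two' hchar (h.eval x)
    rw [hx] at this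
    rw [← hdiv, ← this]; simp) (by
    intro x hx h0
    have hx := (Finset.mem_filter.1 hx).2
    simp [h0] at hx)
  rw [hsum]
  rw [hQ] at htot
  zify at h1 h2 htot hS0 hbig
  have : (1 : ℤ) ≤ 3 ^ c := one_le_pow₀ (by norm_num)
  rw [abs_le]
  constructor <;> nlinarith

lemma weil (h : F[X]) (hns : ∀ p r : F[X], ∀ c : F, p ≠ 0 → p ^ 2 * h ≠ C c * r ^ 2)
    (D a : ℕ) (hD : h.natDegree ≤ D) [CharP F 3] (hQ : Fintype.card F = 3 ^ a) :
    (∑ x : F, quadraticChar F (h.eval x)) ^ 2 ≤ 3 * (8 * D + 12) ^ 2 * 3 ^ a := by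
  have hne : h ≠ 0 := by
    rintro rfl
    exact hns 1 0 0 one_ne_zero (by simp)
  have triv : |∑ x : F, quadraticChar F (h.eval x)| ≤ 3 ^ a := by
    refine (Finset.abs_sum_le_sum_abs _ _).trans ?_
    have : ∀ x ∈ (Finset.univ : Finset F), |quadraticChar F (h.eval x)| ≤ 1 := by
      intro x _
      by_cases ha : h.eval x = 0
      · simp [ha]
      · rcases quadraticChar_dichotomy ha with e | e <;> simp [e]
    refine (Finset.sum_le_sum this).trans ?_
    simp [hQ]
  have main : ∃ c, 2 * c ≤ a + 1 ∧ |∑ x : F, quadraticChar F (h.eval x)| ≤ (8 * D + 12) * 3 ^ c := by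
    by_cases hx : ∃ x0, h.eval x0 ≠ 0
    · obtain ⟨x0, hx0⟩ := hx
      refine ⟨a - a / 2, by omega, ?_⟩
      set c := a - a / 2 with hc
      set b := a / 2 with hb
      have habc : a = b + c := by omega
      by_cases hbig : 8 * D + 12 ≤ 3 ^ c
      · have := weil_zero (h.comp (X + C x0)) (by
          intro p r c hp heq
          apply hns (p.comp (X - C x0)) (r.comp (X - C x0)) c
          · intro h0
            apply hp
            have := congrArg (fun f : F[X] => f.comp (X + C x0)) h0
            simpa [comp_assoc] using this
          · have := congrArg (fun f : F[X] => f.comp (X - C x0)) heq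
            simpa [comp_assoc] using this) (by simpa using hx0) D b c (by
              rw [natDegree_comp]; simpa using hD) (by rw [hQ, habc]) (by omega) hbig
        convert this using 2
        simp only [eval_comp, eval_add, eval_X, eval_C]
        exact (Equiv.sum_comp (Equiv.addRight x0) (fun x => quadraticChar F (h.eval x))).symm
      · refine triv.trans ?_
        push Not at hbig
        have h1 : (3 : ℤ) ^ c ≤ 8 * D + 12 := by exact_mod_cast hbig.le
        have h2 : (3 : ℤ) ^ b ≤ 3 ^ c := pow_le_pow_right₀ (by norm_num) (by omega)
        rw [habc, pow_add]
        have : (0 : ℤ) ≤ 3 ^ c := by positivity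
        nlinarith
    · push Not at hx
      refine ⟨0, by omega, ?_⟩
      refine triv.trans ?_
      have : (3 : ℕ) ^ a ≤ D := by
        rw [← hQ, ← Finset.card_univ]
        refine le_trans ?_ ((card_roots' h).trans hD)
        refine le_trans ?_ (Multiset.toFinset_card_le _)
        apply Finset.card_le_card
        intro x _
        rw [Multiset.mem_toFinset, mem_roots hne]
        exact hx x
      zify at this
      simp only [pow_zero, mul_one]
      have : (0 : ℤ) ≤ D := by positivity
      linarith
  obtain ⟨c, hc, hle⟩ := main
  rw [← sq_abs]
  calc |∑ x : F, quadraticChar F (h.eval x)| ^ 2 ≤ ((8 * D + 12) * 3 ^ c) ^ 2 :=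
        pow_le_pow_left₀ (abs_nonneg _) hle 2
    _ = (8 * D + 12) ^ 2 * 3 ^ (2 * c) := by ring
    _ ≤ (8 * D + 12) ^ 2 * 3 ^ (a + 1) := by
        gcongr
        norm_num
    _ = _ := by ring

end Weil


section Pellet
variable {K : Type} [Field K] [Fintype K]

noncomputable def qs (π g : K[X]) : ℤ :=
  if π ∣ g then 0 else if ∃ s, π ∣ g - s ^ 2 then 1 else -1

lemma qs_eq (π g : K[X]) [Fact (Irreducible π)] [Fintype (AdjoinRoot π)] :
    qs π g = quadraticChar (AdjoinRoot π) (AdjoinRoot.mk π g) := by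
  rw [quadraticChar_apply, quadraticCharFun, qs]
  have : (∃ s, π ∣ g - s ^ 2) ↔ IsSquare (AdjoinRoot.mk π g) := by
    constructor
    · rintro ⟨s, hs⟩
      refine ⟨AdjoinRoot.mk π s, ?_⟩
      rw [← map_mul, ← sq]
      exact AdjoinRoot.mk_eq_mk.2 hs
    · rintro ⟨r, hr⟩
      obtain ⟨s, rfl⟩ := AdjoinRoot.mk_surjective r
      rw [← map_mul, ← sq] at hr
      exact ⟨s, AdjoinRoot.mk_eq_mk.1 hr⟩
  simp only [AdjoinRoot.mk_eq_zero, this]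

noncomputable instance adjFintype (π : K[X]) [Fact (Irreducible π)] : Fintype (AdjoinRoot π) := by
  have : Module.Finite K (AdjoinRoot π) :=
    (AdjoinRoot.powerBasis (Fact.out : Irreducible π).ne_zero).finite
  have : Finite (AdjoinRoot π) := Module.finite_of_finite K
  exact Fintype.ofFinite _

lemma adj_card (π : K[X]) [Fact (Irreducible π)] :
    Fintype.card (AdjoinRoot π) = Fintype.card K ^ π.natDegree := by
  have : Module.Finite K (AdjoinRoot π) :=
    (AdjoinRoot.powerBasis (Fact.out : Irreducible π).ne_zero).finite
  rw [Module.card_eq_pow_finrank (K := K)]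
  congr 1
  exact finrank_quotient_span_eq_natDegree (f := π)

lemma mk_eq_eval (π g : K[X]) (i : ℕ) :
    (g.map (algebraMap K (AdjoinRoot π))).eval (AdjoinRoot.root π ^ (Fintype.card K ^ i)) =
      (AdjoinRoot.mk π g) ^ (Fintype.card K ^ i) := by
  have h1 : AdjoinRoot.mk π g = aeval (AdjoinRoot.root π) g := by rw [AdjoinRoot.aeval_eq]
  have h2 : ∀ i, g ^ (Fintype.card K ^ i) = expand K (Fintype.card K ^ i) g := by
    intro i
    induction i with
    | zero => simp
    | succ i ih =>
      rw [pow_succ, pow_mul, ih, ← map_pow, ← FiniteField.expand_card, expand_expand]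
  rw [← map_pow, h2, ← AdjoinRoot.aeval_eq, expand_aeval, eval_map_algebraMap]

lemma roots_inj (π : K[X]) [hπ : Fact (Irreducible π)] :
    Function.Injective (fun i : Fin π.natDegree => AdjoinRoot.root π ^ (Fintype.card K ^ (i : ℕ))) := by
  have key : ∀ i j : ℕ, i < j → j < π.natDegree →
      AdjoinRoot.root π ^ (Fintype.card K ^ i) ≠ AdjoinRoot.root π ^ (Fintype.card K ^ j) := by
    intro i j hij hj heq
    obtain ⟨d, rfl⟩ : ∃ d, j = d + i := ⟨j - i, by omega⟩
    have hinj : Function.Injective (fun x : AdjoinRoot π => x ^ (Fintype.card K ^ i)) := by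
      induction i with
      | zero => intro x y h; simpa using h
      | succ i ih =>
        have : (fun x : AdjoinRoot π => x ^ (Fintype.card K ^ (i+1))) =
            (FiniteField.frobeniusAlgHom K (AdjoinRoot π))^[i + 1] := by
          funext x
          have : ∀ i x, (FiniteField.frobeniusAlgHom K (AdjoinRoot π))^[i] x = x ^ (Fintype.card K ^ i) := by
            intro i
            induction i with
            | zero => simp
            | succ i ih =>
              intro x
              rw [Function.iterate_succ_apply, ih]
              simp [FiniteField.coe_frobeniusAlgHom, ← pow_mul, pow_succ, mul_comm]
          rw [this]
        rw [this]
        exact Function.Injective.iterate (RingHom.injective _) _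
    have h1 : AdjoinRoot.root π = AdjoinRoot.root π ^ (Fintype.card K ^ d) := by
      apply hinj
      simp only
      rw [heq, ← pow_mul, pow_add]
    have h2 : π ∣ X ^ (Nat.card K) ^ d - X := by
      rw [← AdjoinRoot.mk_eq_zero, map_sub, map_pow, AdjoinRoot.mk_X, Nat.card_eq_fintype_card, ← h1, sub_self]
    have h3 := hπ.out.natDegree_dvd_of_dvd_X_pow_card_pow_sub_X h2
    have := Nat.le_of_dvd (by omega) h3
    omega
  intro i j h
  rcases lt_trichotomy (i : ℕ) j with h' | h' | h'
  · exact absurd h (key _ _ h' j.2)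
  · exact Fin.ext h'
  · exact absurd h.symm (key _ _ h' i.2)

lemma map_eq_nodal (π : K[X]) (hm : π.Monic) [hπ : Fact (Irreducible π)] :
    π.map (algebraMap K (AdjoinRoot π)) = Lagrange.nodal Finset.univ
      (fun i : Fin π.natDegree => AdjoinRoot.root π ^ (Fintype.card K ^ (i : ℕ))) := by
  refine eq_of_monic_of_dvd_of_natDegree_le ?_ ?_ ?_ ?_
  · exact Lagrange.nodal_monic
  · exact hm.map _
  · rw [Lagrange.nodal]
    apply Finset.prod_dvd_of_coprime
    · intro i _ j _ hij
      exact isCoprime_X_sub_C_of_isUnit_sub (by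
        rw [isUnit_iff_ne_zero, sub_ne_zero]
        exact fun h => hij (roots_inj π h))
    · intro i _
      rw [dvd_iff_isRoot, IsRoot, mk_eq_eval, AdjoinRoot.mk_self]
      exact zero_pow (pow_ne_zero _ Fintype.card_ne_zero)
  · rw [Lagrange.natDegree_nodal, natDegree_map, Finset.card_univ, Fintype.card_fin]

lemma res_map (π g : K[X]) (hm : π.Monic) [hπ : Fact (Irreducible π)] :
    algebraMap K (AdjoinRoot π) (resultant π g) =
      ∏ i : Fin π.natDegree,
        (g.map (algebraMap K (AdjoinRoot π))).eval (AdjoinRoot.root π ^ (Fintype.card K ^ (i : ℕ))) := by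
  rw [← resultant_map_map]
  have hn := map_eq_nodal π hm
  have hd : π.natDegree = (π.map (algebraMap K (AdjoinRoot π))).natDegree := by rw [natDegree_map]
  conv_lhs => rw [hd]
  have hs : (π.map (algebraMap K (AdjoinRoot π))).Splits := by
    rw [hn, Lagrange.nodal]
    exact Splits.prod (fun i _ => Splits.X_sub_C _)
  rw [resultant_eq_prod_eval _ _ _ (natDegree_map_le) hs, (hm.map _).leadingCoeff, one_pow, one_mul]
  have hr : (π.map (algebraMap K (AdjoinRoot π))).roots = (Finset.univ.val.map
      (fun i : Fin π.natDegree => AdjoinRoot.root π ^ (Fintype.card K ^ (i : ℕ)))) := by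
    rw [hn, Lagrange.nodal]
    exact roots_multiset_prod_X_sub_C (Multiset.map _ Finset.univ.val) |> fun h => by
      rw [Multiset.map_map] at h; exact h
  rw [hr, Multiset.map_map]
  rfl

lemma int_eq_of_cast {E : Type} [Field E] (h2 : (2 : E) ≠ 0) {a b : ℤ}
    (ha : a = 0 ∨ a = 1 ∨ a = -1) (hb : b = 0 ∨ b = 1 ∨ b = -1) (h : (a : E) = b) : a = b := by
  have e1 : (1 : E) ≠ -1 := by
    intro h; apply h2; rw [← one_add_one_eq_two]; nth_rewrite 1 [h]; simp
  rcases ha with rfl | rfl | rfl <;> rcases hb with rfl | rfl | rfl <;> simp_all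

lemma qc_cases {E : Type} [Field E] [Fintype E] (a : E) :
    quadraticChar E a = 0 ∨ quadraticChar E a = 1 ∨ quadraticChar E a = -1 := by
  by_cases ha : a = 0
  · simp [ha]
  · right; exact quadraticChar_dichotomy ha

lemma two_ne {E : Type} [Field E] [CharP E 3] : (2 : E) ≠ 0 := by
  intro h
  have := (CharP.cast_eq_zero_iff E 3 2).1 (by exact_mod_cast h)
  omega

lemma rc_ne {E : Type} [Field E] [CharP E 3] : ringChar E ≠ 2 := by
  rw [ringChar.eq E 3]; norm_num

instance adjCharP (π : K[X]) [Fact (Irreducible π)] [CharP K 3] : CharP (AdjoinRoot π) 3 :=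
  charP_of_injective_algebraMap (algebraMap K (AdjoinRoot π)).injective 3

lemma card_odd [CharP K 3] : Odd (Fintype.card K) := by
  have : Fact (Nat.Prime 3) := ⟨by norm_num⟩
  obtain ⟨n, hn⟩ := FiniteField.card K 3
  rw [hn.2]; exact Odd.pow (by decide)

lemma qs_res [CharP K 3] (π g : K[X]) (hm : π.Monic) (hπ : Irreducible π) :
    qs π g = quadraticChar K (resultant π g) := by
  have : Fact (Irreducible π) := ⟨hπ⟩
  rw [qs_eq]
  apply int_eq_of_cast (E := AdjoinRoot π) two_ne (qc_cases _) (qc_cases _)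
  rw [quadraticChar_eq_pow_of_char_ne_two' rc_ne]
  have h1 := congrArg (algebraMap K (AdjoinRoot π))
    (quadraticChar_eq_pow_of_char_ne_two' (F := K) rc_ne (resultant π g))
  rw [map_pow, res_map π g hm] at h1
  rw [map_intCast] at h1
  rw [h1]
  simp only [mk_eq_eval]
  rw [Finset.prod_pow_eq_pow_sum, ← pow_mul]
  congr 1
  rw [adj_card]
  obtain ⟨m, hm⟩ := card_odd (K := K)
  have h3 := Nat.geomSum_eq (m := Fintype.card K) Fintype.one_lt_card π.natDegree
  rw [Fin.sum_univ_eq_sum_range (fun i => Fintype.card K ^ i)]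
  have h4 := Nat.geomSum_eq (m := Fintype.card K) Fintype.one_lt_card π.natDegree
  have h5 : (∑ i ∈ Finset.range π.natDegree, Fintype.card K ^ i) * (Fintype.card K - 1) =
      Fintype.card K ^ π.natDegree - 1 := by
    have := geom_sum_mul (Fintype.card K : ℤ) π.natDegree
    have h1 : 1 ≤ Fintype.card K := Fintype.card_pos
    have h2 : 1 ≤ Fintype.card K ^ π.natDegree := Nat.one_le_pow _ _ h1
    zify [h1, h2]
    exact this
  have : Fintype.card K / 2 * 2 = Fintype.card K - 1 := by omega
  rw [← this, ← mul_assoc] at h5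
  have h6 : Odd (Fintype.card K ^ π.natDegree) := Odd.pow ⟨m, hm⟩
  obtain ⟨m', hm'⟩ := h6
  omega

lemma qs_recip [CharP K 3] (π₁ π₂ : K[X]) (h1 : π₁.Monic) (i1 : Irreducible π₁)
    (h2 : π₂.Monic) (i2 : Irreducible π₂) :
    qs π₁ π₂ = quadraticChar K (-1) ^ (π₁.natDegree * π₂.natDegree) * qs π₂ π₁ := by
  rw [qs_res _ _ h1 i1, qs_res _ _ h2 i2, resultant_comm, map_mul, map_pow]

lemma qs_mul (π f g : K[X]) (hπ : Irreducible π) : qs π (f * g) = qs π f * qs π g := by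
  have : Fact (Irreducible π) := ⟨hπ⟩
  simp only [qs_eq, map_mul]

lemma qs_congr (π f g : K[X]) (hπ : Irreducible π) (h : π ∣ f - g) : qs π f = qs π g := by
  have : Fact (Irreducible π) := ⟨hπ⟩
  simp only [qs_eq, AdjoinRoot.mk_eq_mk.2 h]

lemma qs_one (π : K[X]) (hπ : Irreducible π) : qs π 1 = 1 := by
  have : Fact (Irreducible π) := ⟨hπ⟩
  simp only [qs_eq, map_one]

lemma qs_C [CharP K 3] (π : K[X]) (hm : π.Monic) (hπ : Irreducible π) (a : K) :
    qs π (C a) = quadraticChar K a ^ π.natDegree := by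
  rw [qs_res π _ hm hπ]
  have : resultant π (C a) = a ^ π.natDegree := by simp
  rw [this, map_pow]

lemma qs_cases (π f : K[X]) : qs π f = 0 ∨ qs π f = 1 ∨ qs π f = -1 := by
  unfold qs; split_ifs <;> simp

lemma qs_eq_zero (π f : K[X]) : qs π f = 0 ↔ π ∣ f := by
  unfold qs; split_ifs <;> simp_all

end Pellet


section Pellet2
variable {K : Type} [Field K] [Fintype K]

lemma vdm_frob {E : Type} [Field E] (φ : E →+* E) (a : E) (n : ℕ) (q : ℕ) (hφ : ∀ x, φ x = x ^ q)
    (k : ℕ) (hk : 1 ≤ k) (ha : a ^ (q ^ k) = a) :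
    φ (Matrix.vandermonde (fun i : Fin k => a ^ (q ^ (i : ℕ)))).det =
      (-1) ^ (k + 1) * (Matrix.vandermonde (fun i : Fin k => a ^ (q ^ (i : ℕ)))).det := by
  obtain ⟨n, rfl⟩ : ∃ n, k = n + 1 := ⟨k - 1, by omega⟩
  rw [RingHom.map_det]
  have : (φ.mapMatrix (Matrix.vandermonde (fun i : Fin (n+1) => a ^ (q ^ (i : ℕ))))) =
      (Matrix.vandermonde (fun i : Fin (n+1) => a ^ (q ^ (i : ℕ)))).submatrix (finRotate (n+1)) id := by
    ext i j
    simp only [RingHom.mapMatrix_apply, Matrix.map_apply, Matrix.vandermonde_apply, map_pow,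
      Matrix.submatrix_apply, id]
    congr 1
    rw [hφ]
    rcases Fin.eq_castSucc_or_eq_last i with ⟨i, rfl⟩ | rfl
    · have e := finRotate_of_lt i.2
      have e' : (finRotate (n+1)) i.castSucc = ⟨(i : ℕ) + 1, by omega⟩ := e
      rw [e', ← pow_mul, ← pow_succ']
      simp
    · rw [finRotate_last, ← pow_mul, ← pow_succ']
      simp [ha]
  rw [this, Matrix.det_permute, sign_finRotate]
  simp [pow_add]

lemma prod_offdiag {E : Type} [Field E] (k : ℕ) (v : Fin k → E) :
    ∏ i, ((derivative (Lagrange.nodal Finset.univ v)).eval (v i)) =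
      (-1) ^ (k.choose 2) * (Matrix.vandermonde v).det ^ 2 := by
  have h1 : ∀ i, ((derivative (Lagrange.nodal Finset.univ v)).eval (v i)) =
      ∏ j ∈ {i}ᶜ, (v i - v j) := by
    intro i
    rw [Lagrange.eval_nodal_derivative_eval_node_eq (Finset.mem_univ i), Lagrange.eval_nodal]
    congr 1
    ext j; simp
  simp only [h1]
  rw [← Finset.prod_prod_Ioi_mul_eq_prod_prod_off_diag (fun j i => v i - v j)]
  have h2 : ∀ i : Fin k, ∏ j ∈ Finset.Ioi i, ((v i - v j) * (v j - v i)) =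
      (-1) ^ (k - 1 - (i : ℕ)) * (∏ j ∈ Finset.Ioi i, (v j - v i)) ^ 2 := by
    intro i
    rw [← Fin.card_Ioi, ← Finset.prod_const, ← Finset.prod_pow, ← Finset.prod_mul_distrib]
    exact Finset.prod_congr rfl (fun j _ => by ring)
  rw [Finset.prod_congr rfl (fun i _ => h2 i), Finset.prod_mul_distrib, Finset.prod_pow_eq_pow_sum,
    Finset.prod_pow, Matrix.det_vandermonde]
  congr 2
  rw [Fin.sum_univ_eq_sum_range (fun i => k - 1 - i), Finset.sum_range_reflect (fun i => i), Finset.sum_range_id,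
    Nat.choose_two_right]

lemma neg_one_cases : quadraticChar K (-1) ^ 2 = 1 := by
  rw [← map_pow]; simp

lemma qs_deriv [CharP K 3] (π : K[X]) (hm : π.Monic) (hπ : Irreducible π) :
    qs π (derivative π) = quadraticChar K (-1) ^ (π.natDegree.choose 2) * (-1) ^ (π.natDegree + 1) := by
  have : Fact (Irreducible π) := ⟨hπ⟩
  set k := π.natDegree with hk
  set E := AdjoinRoot π with hE
  set V : E := (Matrix.vandermonde (fun i : Fin π.natDegree => AdjoinRoot.root π ^ (Fintype.card K ^ (i : ℕ)))).det with hV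
  have hV0 : V ≠ 0 := Matrix.det_vandermonde_ne_zero_iff.2 (roots_inj π)
  have hVq : V ^ (Fintype.card K) = (-1) ^ (k + 1) * V := by
    have := vdm_frob (FiniteField.frobeniusAlgHom K E : E →+* E) (AdjoinRoot.root π) 0 (Fintype.card K)
      (fun x => by simp) π.natDegree hπ.natDegree_pos (by
        rw [← adj_card]; exact FiniteField.pow_card _)
    rw [← hV] at this
    simpa using this
  have hr : algebraMap K E (resultant π (derivative π)) = (-1) ^ (k.choose 2) * V ^ 2 := by
    rw [res_map π _ hm]
    rw [← derivative_map, map_eq_nodal π hm]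
    exact prod_offdiag _ _
  rw [qs_res _ _ hm hπ]
  have h3 : quadraticChar K ((-1) ^ (k.choose 2) * resultant π (derivative π)) = (-1) ^ (k + 1) := by
    apply int_eq_of_cast (E := E) two_ne (qc_cases _)
    · right; exact neg_one_pow_eq_or ℤ _
    have h1 := congrArg (algebraMap K E)
      (quadraticChar_eq_pow_of_char_ne_two' (F := K) rc_ne ((-1) ^ (k.choose 2) * resultant π (derivative π)))
    rw [map_intCast] at h1
    rw [h1]
    rw [map_pow, map_mul, hr, map_pow, map_neg, map_one, ← mul_assoc, ← mul_pow]
    rw [neg_mul_neg, one_mul, one_pow, one_mul, ← pow_mul]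
    obtain ⟨m, hm⟩ := card_odd (K := K)
    have : 2 * (Fintype.card K / 2) + 1 = Fintype.card K := by omega
    rw [← this, pow_succ] at hVq
    push_cast
    exact mul_right_cancel₀ hV0 hVq
  rw [map_mul, map_pow] at h3
  rw [← h3, ← mul_assoc, ← pow_add, ← two_mul, pow_mul, neg_one_cases, one_pow, one_mul]

noncomputable def JJ (s : Multiset K[X]) (g : K[X]) : ℤ := (s.map (fun π => qs π g)).prod

def MI (s : Multiset K[X]) : Prop := ∀ π ∈ s, π.Monic ∧ Irreducible π

lemma MI.cons {π : K[X]} {s : Multiset K[X]} (h : MI (π ::ₘ s)) : (π.Monic ∧ Irreducible π) ∧ MI s :=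
  ⟨h π (by simp), fun x hx => h x (by simp [hx])⟩

lemma JJ_cons (π : K[X]) (s : Multiset K[X]) (g : K[X]) : JJ (π ::ₘ s) g = qs π g * JJ s g := by
  simp [JJ]

lemma JJ_zero (g : K[X]) : JJ 0 g = 1 := by simp [JJ]

lemma JJ_mul {s : Multiset K[X]} (hs : MI s) (f g : K[X]) : JJ s (f * g) = JJ s f * JJ s g := by
  rw [JJ, JJ, JJ, ← Multiset.prod_map_mul]
  congr 1
  exact Multiset.map_congr rfl (fun π hπ => qs_mul π f g (hs π hπ).2)

lemma JJ_one {s : Multiset K[X]} (hs : MI s) : JJ s 1 = 1 := by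
  apply Multiset.prod_eq_one
  intro x hx
  obtain ⟨π, hπ, rfl⟩ := Multiset.mem_map.1 hx
  exact qs_one _ (hs π hπ).2

lemma JJ_pow {s : Multiset K[X]} (hs : MI s) (f : K[X]) (n : ℕ) : JJ s (f ^ n) = JJ s f ^ n := by
  induction n with
  | zero => simp [JJ_one hs]
  | succ n ih => rw [pow_succ, JJ_mul hs, ih, pow_succ]

lemma MI.prod_monic {s : Multiset K[X]} (hs : MI s) : s.prod.Monic :=
  monic_multiset_prod_of_monic_id hs
where
  monic_multiset_prod_of_monic_id {s : Multiset K[X]} (hs : MI s) : s.prod.Monic := by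
    have := monic_multiset_prod_of_monic s (fun x => x) (fun i hi => (hs i hi).1)
    simpa using this

lemma JJ_C [CharP K 3] {s : Multiset K[X]} (hs : MI s) (a : K) :
    JJ s (C a) = quadraticChar K a ^ s.prod.natDegree := by
  induction s using Multiset.induction with
  | empty => simp [JJ_zero]
  | cons π s ih =>
    obtain ⟨h1, h2⟩ := hs.cons
    rw [JJ_cons, ih h2, qs_C _ h1.1 h1.2, Multiset.prod_cons, h1.1.natDegree_mul h2.prod_monic, pow_add]

lemma qs_recip_multi [CharP K 3] {π : K[X]} (hm : π.Monic) (hπ : Irreducible π) {s : Multiset K[X]} (hs : MI s) :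
    qs π s.prod = quadraticChar K (-1) ^ (π.natDegree * s.prod.natDegree) * JJ s π := by
  induction s using Multiset.induction with
  | empty => simp [JJ_zero, qs_one π hπ]
  | cons p s ih =>
    obtain ⟨h1, h2⟩ := hs.cons
    rw [JJ_cons, Multiset.prod_cons, qs_mul _ _ _ hπ, ih h2, qs_recip _ _ hm hπ h1.1 h1.2,
      h1.1.natDegree_mul h2.prod_monic]
    ring

lemma JJ_recip [CharP K 3] {s t : Multiset K[X]} (hs : MI s) (ht : MI t) :
    JJ s t.prod = quadraticChar K (-1) ^ (s.prod.natDegree * t.prod.natDegree) * JJ t s.prod := by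
  induction s using Multiset.induction with
  | empty => simp [JJ_zero, JJ_one ht]
  | cons p s ih =>
    obtain ⟨h1, h2⟩ := hs.cons
    rw [JJ_cons, Multiset.prod_cons, JJ_mul ht, ih h2, qs_recip_multi h1.1 h1.2 ht,
      h1.1.natDegree_mul h2.prod_monic]
    ring

lemma dvd_prod_mem {s : Multiset K[X]} (hs : MI s) {π : K[X]} (hm : π.Monic) (hπ : Irreducible π)
    (h : π ∣ s.prod) : π ∈ s := by
  obtain ⟨p, hp, hd⟩ := hπ.prime.exists_mem_multiset_dvd h
  have : π = p := eq_of_monic_of_associated hm (hs p hp).1 (hπ.associated_of_dvd (hs p hp).2 hd)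
  rwa [this]

lemma JJ_cases (s : Multiset K[X]) (g : K[X]) : JJ s g = 0 ∨ JJ s g = 1 ∨ JJ s g = -1 := by
  induction s using Multiset.induction with
  | empty => simp [JJ_zero]
  | cons p s ih =>
    rw [JJ_cons]
    rcases ih with h | h | h <;> rcases qs_cases p g with h' | h' | h' <;> simp [h, h']

lemma JJ_ne_zero {s : Multiset K[X]} {g : K[X]} (h : ∀ π ∈ s, ¬ π ∣ g) : JJ s g ≠ 0 := by
  rw [JJ]
  apply Multiset.prod_ne_zero
  intro h0
  obtain ⟨π, hπ, h1⟩ := Multiset.mem_map.1 h0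
  exact h π hπ ((qs_eq_zero _ _).1 h1)

lemma JJ_eq_zero {s : Multiset K[X]} {g π : K[X]} (h : π ∈ s) (h' : π ∣ g) : JJ s g = 0 := by
  rw [JJ]
  apply Multiset.prod_eq_zero
  exact Multiset.mem_map.2 ⟨π, h, (qs_eq_zero _ _).2 h'⟩

lemma JJ_congr {s : Multiset K[X]} (hs : MI s) {f g : K[X]} (h : s.prod ∣ f - g) : JJ s f = JJ s g := by
  rw [JJ, JJ]
  congr 1
  exact Multiset.map_congr rfl (fun π hπ => qs_congr π f g (hs π hπ).2 ((Multiset.dvd_prod hπ).trans h))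

lemma JJ_sq {s : Multiset K[X]} {g : K[X]} (h : JJ s g ≠ 0) : JJ s g * JJ s g = 1 := by
  rcases JJ_cases s g with h' | h' | h' <;> simp_all

lemma pellet_multi [CharP K 3] {s : Multiset K[X]} (hs : MI s) :
    JJ s (derivative s.prod) = quadraticChar K (-1) ^ (s.prod.natDegree.choose 2) *
      (-1) ^ s.prod.natDegree * (if s.Nodup then (-1) ^ Multiset.card s else 0) := by
  induction s using Multiset.induction with
  | empty => simp [JJ_zero]
  | cons p s ih =>
    obtain ⟨h1, h2⟩ := hs.cons
    by_cases hp : p ∈ s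
    · have : ¬ (p ::ₘ s).Nodup := by simp [hp]
      rw [if_neg this, mul_zero]
      apply JJ_eq_zero (Multiset.mem_cons_self p s)
      obtain ⟨r, hr⟩ := Multiset.dvd_prod hp
      rw [Multiset.prod_cons, hr]
      simp only [derivative_mul]
      exact Dvd.intro (derivative p * r + derivative p * r + p * derivative r) (by ring)
    · have hnd : (p ::ₘ s).Nodup ↔ s.Nodup := by simp [hp]
      simp only [hnd, Multiset.card_cons]
      have hps : ¬ p ∣ s.prod := fun h => hp (dvd_prod_mem h2 h1.1 h1.2 h)
      have hsp : ∀ π ∈ s, ¬ π ∣ p := by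
        intro π hπ hd
        have : π = p := eq_of_monic_of_associated (h2 π hπ).1 h1.1 ((h2 π hπ).2.associated_of_dvd h1.2 hd)
        exact hp (this ▸ hπ)
      rw [JJ_cons, Multiset.prod_cons, derivative_mul, h1.1.natDegree_mul h2.prod_monic]
      rw [qs_congr p _ (derivative p * s.prod) h1.2 ⟨derivative s.prod, by ring⟩,
        JJ_congr h2 (g := p * derivative s.prod) ⟨derivative p, by ring⟩,
        qs_mul _ _ _ h1.2, JJ_mul h2, ih h2, qs_deriv p h1.1 h1.2, qs_recip_multi h1.1 h1.2 h2]
      have hch : (p.natDegree + s.prod.natDegree).choose 2 = p.natDegree.choose 2 +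
          s.prod.natDegree.choose 2 + p.natDegree * s.prod.natDegree := by
        have := Nat.add_choose_eq p.natDegree s.prod.natDegree 2
        rw [this]
        simp [Finset.antidiagonal, Finset.Nat.antidiagonal_succ]
        ring
      rw [hch]
      have hsq := JJ_sq (JJ_ne_zero hsp)
      split_ifs
      · simp only [pow_add, pow_one]
        linear_combination (quadraticChar K (-1) ^ (p.natDegree.choose 2) * (-1) ^ (p.natDegree) * (-1) * quadraticChar K (-1) ^ (p.natDegree * s.prod.natDegree) * (quadraticChar K (-1) ^ (s.prod.natDegree.choose 2) *
      (-1) ^ s.prod.natDegree * (-1) ^ Multiset.card s)) * hsq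
      · simp

open UniqueFactorizationMonoid in
lemma nf_MI (f : K[X]) : MI (normalizedFactors f) := by
  intro π hπ
  have h1 := irreducible_of_normalized_factor π hπ
  have h2 := normalize_normalized_factor π hπ
  refine ⟨?_, h1⟩
  rw [← h2]
  exact monic_normalize h1.ne_zero

open UniqueFactorizationMonoid in
lemma nf_prod (f : K[X]) (hf : f.Monic) : (normalizedFactors f).prod = f :=
  eq_of_monic_of_associated (nf_MI f).prod_monic hf (prod_normalizedFactors hf.ne_zero)

open UniqueFactorizationMonoid in
lemma pellet [CharP K 3] (f : K[X]) (hf : f.Monic) :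
    JJ (normalizedFactors f) (derivative f) = quadraticChar K (-1) ^ (f.natDegree.choose 2) *
      (-1) ^ f.natDegree * pmu f := by
  have := pellet_multi (nf_MI f)
  rw [nf_prod f hf] at this
  rw [this, pmu]
  simp only [squarefree_iff_nodup_normalizedFactors hf.ne_zero]

open UniqueFactorizationMonoid in
lemma claimA [CharP K 3] (P : K[X]) (hP : P.Monic) (hirr : Irreducible P) (N m : ℕ) (h' : K[X]) (h0 : h' ≠ 0) :
    ∃ ε : ℤ, (ε = 1 ∨ ε = -1) ∧ ∀ f : K[X], f.Monic → f.natDegree = N → derivative f = P ^ (3 * m) * h' →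
      P ∣ f - 1 → pmu f = ε * JJ (normalizedFactors h') f := by
  set H := normalizedFactors h' with hH
  set c := h'.leadingCoeff with hc
  have hMI : MI H := nf_MI h'
  have hh : h' = C c * H.prod := by
    have h2 : normalize h' = H.prod := by
      apply eq_of_monic_of_associated (monic_normalize h0) hMI.prod_monic
      exact (normalize_associated h').trans (prod_normalizedFactors h0).symm
    have h3 : H.prod = C c⁻¹ * h' := by
      rw [← h2]
      rw [normalize_apply, coe_normUnit_of_ne_zero h0, mul_comm]
    rw [h3, ← mul_assoc, ← C_mul, mul_inv_cancel₀ (leadingCoeff_ne_zero.2 h0), C_1, one_mul]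
  have pm : ∀ a : K, a ≠ 0 → ∀ n : ℕ, (quadraticChar K a ^ n = 1 ∨ quadraticChar K a ^ n = -1) := by
    intro a ha n
    rcases quadraticChar_dichotomy ha with h | h
    · rw [h]; simp
    · rw [h]; exact neg_one_pow_eq_or ℤ n
  set u := quadraticChar K (-1) with hu
  have hu' : ∀ n : ℕ, u ^ n = 1 ∨ u ^ n = -1 := pm (-1) (by simp)
  have hn := neg_one_pow_eq_or ℤ N
  refine ⟨u ^ (N.choose 2) * (-1) ^ N * (u ^ (N * P.natDegree)) ^ (3 * m) * quadraticChar K c ^ N *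
     u ^ (N * H.prod.natDegree), ?_, ?_⟩
  · rw [← pow_mul]
    rcases hu' (N.choose 2) with h1 | h1 <;> rcases hn with h2 | h2 <;>
      rcases hu' (N * P.natDegree * (3 * m)) with h3 | h3 <;>
      rcases pm c (leadingCoeff_ne_zero.2 h0) N with h4 | h4 <;>
      rcases hu' (N * H.prod.natDegree) with h5 | h5 <;> rw [h1, h2, h3, h4, h5] <;> norm_num
  · intro f hf hfN hd hPf
    have p1 := pellet f hf
    have hM := nf_MI f
    have e1 : JJ (normalizedFactors f) P = u ^ (N * P.natDegree) := by
      have hPM : MI ({P} : Multiset K[X]) := by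
        intro x hx; rw [Multiset.mem_singleton] at hx; rw [hx]; exact ⟨hP, hirr⟩
      have := JJ_recip hM hPM
      rw [nf_prod f hf, Multiset.prod_singleton, hfN] at this
      rw [this]
      have e : JJ {P} f = 1 := by
        rw [JJ, Multiset.map_singleton, Multiset.prod_singleton, qs_congr P f 1 hirr hPf, qs_one P hirr]
      rw [e, mul_one]
    have e2 : JJ (normalizedFactors f) H.prod = u ^ (N * H.prod.natDegree) * JJ H f := by
      have := JJ_recip hM hMI
      rwa [nf_prod f hf, hfN] at this
    have e3 := JJ_C hM c
    rw [nf_prod f hf, hfN] at e3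
    have e4 : derivative f = P ^ (3*m) * (C c * H.prod) := by rw [hd, ← hh]
    rw [e4, JJ_mul hM, JJ_pow hM, JJ_mul hM, e1, e2, e3, hfN] at p1
    have s1 : (u ^ (N.choose 2)) * (u ^ (N.choose 2)) = 1 := by
      rcases hu' (N.choose 2) with h | h <;> simp [h]
    have s2 : ((-1 : ℤ) ^ N) * ((-1) ^ N) = 1 := by
      rcases hn with h | h <;> simp [h]
    linear_combination (-(u ^ (N.choose 2)) * (-1) ^ N) * p1 - pmu f * s1 - pmu f * u ^ (N.choose 2) * u ^ (N.choose 2) * s2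

end Pellet2


section Counts
variable {K : Type} [Field K] [Fintype K]

variable (K) in
noncomputable def PL (n : ℕ) : Finset K[X] := Finset.univ.image (toP n)

lemma mem_PL {n : ℕ} {g : K[X]} : g ∈ PL K n ↔ g.degree < n := by
  simp only [PL, Finset.mem_image, Finset.mem_univ, true_and]
  constructor
  · rintro ⟨v, rfl⟩; exact toP_degree _ _
  · exact toP_surj _ _

lemma card_PL (n : ℕ) : (PL K n).card = Fintype.card K ^ n := by
  rw [PL, Finset.card_image_of_injective _ (toP_inj n)]
  simp

lemma zero_mem_PL (n : ℕ) : (0 : K[X]) ∈ PL K n := by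
  rw [mem_PL, degree_zero]; exact WithBot.bot_lt_coe n

lemma add_mem_PL {n : ℕ} {f g : K[X]} (hf : f ∈ PL K n) (hg : g ∈ PL K n) : f + g ∈ PL K n := by
  rw [mem_PL] at *
  exact (degree_add_le f g).trans_lt (max_lt hf hg)

lemma sub_mem_PL {n : ℕ} {f g : K[X]} (hf : f ∈ PL K n) (hg : g ∈ PL K n) : f - g ∈ PL K n := by
  rw [mem_PL] at *
  exact (degree_sub_le f g).trans_lt (max_lt hf hg)

lemma mul_mem_PL {a b : ℕ} {f g : K[X]} (hf : f.natDegree ≤ a) (hg : g ∈ PL K b) : f * g ∈ PL K (a + b) := by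
  rw [mem_PL] at *
  by_cases h : f * g = 0
  · rw [h, degree_zero]; exact WithBot.bot_lt_coe _
  · have hf0 : f ≠ 0 := left_ne_zero_of_mul h
    have hg0 : g ≠ 0 := right_ne_zero_of_mul h
    rw [← natDegree_lt_iff_degree_lt h, natDegree_mul hf0 hg0]
    rw [← natDegree_lt_iff_degree_lt hg0] at hg
    omega

lemma mem_PL_nat {n : ℕ} {g : K[X]} (hg : g ∈ PL K n) (h0 : g ≠ 0) : g.natDegree < n := by
  rw [mem_PL] at hg
  exact (natDegree_lt_iff_degree_lt h0).2 hg

lemma mem_PL_of_nat {n : ℕ} {g : K[X]} (hg : g.natDegree < n) : g ∈ PL K n := by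
  rw [mem_PL]
  exact (degree_le_natDegree).trans_lt (by exact_mod_cast hg)

lemma eq_zero_of_dvd_PL {n : ℕ} {g d : K[X]} (hg : g ∈ PL K n) (hd : n ≤ d.natDegree) (h : d ∣ g) : g = 0 := by
  by_contra h0
  have := natDegree_le_of_dvd h h0
  have := mem_PL_nat hg h0
  omega

variable (K) in
noncomputable def Mo (e : ℕ) : Finset K[X] := (PL K e).image (fun g => X ^ e + g)

lemma mem_Mo {e : ℕ} {g : K[X]} : g ∈ Mo K e ↔ g.Monic ∧ g.natDegree = e := by
  simp only [Mo, Finset.mem_image]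
  constructor
  · rintro ⟨v, hv, rfl⟩
    rw [mem_PL] at hv
    refine ⟨monic_X_pow_add hv, ?_⟩
    rw [natDegree_add_eq_left_of_degree_lt (by rwa [degree_X_pow]), natDegree_X_pow]
  · rintro ⟨hm, rfl⟩
    refine ⟨g - X ^ g.natDegree, ?_, by ring⟩
    rw [mem_PL, ← degree_eq_natDegree hm.ne_zero]
    apply degree_sub_lt_left
    · rw [degree_X_pow, degree_eq_natDegree hm.ne_zero]
    · exact hm.ne_zero
    · rw [hm.leadingCoeff, (monic_X_pow _).leadingCoeff]

lemma card_Mo (e : ℕ) : (Mo K e).card = Fintype.card K ^ e := by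
  rw [Mo, Finset.card_image_of_injective _ (add_right_injective _), card_PL]

lemma add_mem_Mo {e : ℕ} {f g : K[X]} (hf : f ∈ Mo K e) (hg : g ∈ PL K e) : f + g ∈ Mo K e := by
  rw [mem_Mo] at *
  rw [mem_PL] at hg
  have h : g.degree < f.degree := by rwa [degree_eq_natDegree hf.1.ne_zero, hf.2]
  refine ⟨hf.1.add_of_left h, ?_⟩
  rw [natDegree_add_eq_left_of_degree_lt h, hf.2]

variable (K) in
noncomputable def Pr (k : ℕ) : Finset K[X] := (Mo K k).filter Irreducible

lemma mem_Pr {k : ℕ} {π : K[X]} : π ∈ Pr K k ↔ (π.Monic ∧ Irreducible π) ∧ π.natDegree = k := by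
  rw [Pr, Finset.mem_filter, mem_Mo]; tauto

lemma coprime_of_MI {π₁ π₂ : K[X]} (h1 : π₁.Monic ∧ Irreducible π₁) (h2 : π₂.Monic ∧ Irreducible π₂)
    (hne : π₁ ≠ π₂) : IsCoprime π₁ π₂ := by
  rw [h1.2.coprime_iff_not_dvd]
  intro hd
  exact hne (eq_of_monic_of_associated h1.1 h2.1 (h1.2.associated_of_dvd h2.2 hd))

lemma prod_dvd_of_MI {ι : Type*} (s : Finset ι) (p : ι → K[X]) (hp : ∀ i ∈ s, (p i).Monic ∧ Irreducible (p i))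
    (hinj : ∀ i ∈ s, ∀ j ∈ s, p i = p j → i = j) (z : K[X]) (h : ∀ i ∈ s, p i ∣ z) : ∏ i ∈ s, p i ∣ z := by
  apply Finset.prod_dvd_of_coprime _ h
  intro i hi j hj hij
  exact coprime_of_MI (hp i hi) (hp j hj) (fun h => hij (hinj i hi j hj h))

lemma natDegree_prod_MI {ι : Type*} (s : Finset ι) (p : ι → K[X]) (hp : ∀ i ∈ s, (p i).Monic) :
    (∏ i ∈ s, p i).natDegree = ∑ i ∈ s, (p i).natDegree :=
  natDegree_prod_of_monic s p hp

lemma Pr_upper (k : ℕ) : k * (Pr K k).card ≤ Fintype.card K ^ k := by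
  rcases Nat.eq_zero_or_pos k with rfl | hk
  · simp
  have h1 : ∏ π ∈ Pr K k, π ∣ X ^ (Nat.card K) ^ k - X := by
    apply prod_dvd_of_MI _ _ (fun i hi => (mem_Pr.1 hi).1) (fun _ _ _ _ h => h)
    intro π hπ
    have := mem_Pr.1 hπ
    rw [← this.1.2.natDegree_dvd_iff_dvd_X_pow_card_pow_sub_X, this.2]
  have hc : 1 < Nat.card K := by rw [Nat.card_eq_fintype_card]; exact Fintype.one_lt_card
  have h2 := natDegree_le_of_dvd h1 (FiniteField.X_pow_card_pow_sub_X_ne_zero K (by omega) hc)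
  rw [FiniteField.X_pow_card_pow_sub_X_natDegree_eq K (by omega) hc,
    natDegree_prod_MI _ _ (fun i hi => (mem_Pr.1 hi).1.1),
    Finset.sum_congr rfl (fun i hi => (mem_Pr.1 hi).2), Finset.sum_const, smul_eq_mul,
    Nat.card_eq_fintype_card] at h2
  linarith

open UniqueFactorizationMonoid in
lemma Pr_lower [CharP K 3] (A : ℕ) (hA : 3 ≤ A) : Fintype.card K ^ A ≤ 2 * (A * (Pr K A).card) := by
  set q := Fintype.card K with hq
  have hc : 1 < Nat.card K := by rw [Nat.card_eq_fintype_card]; exact Fintype.one_lt_card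
  have hq3 : 2 < q := by
    have h1 : 1 < q := Fintype.one_lt_card
    obtain ⟨m, hm⟩ := card_odd (K := K)
    omega
  set f : K[X] := X ^ (Nat.card K) ^ A - X with hf
  have hf0 : f ≠ 0 := FiniteField.X_pow_card_pow_sub_X_ne_zero K (by omega) hc
  have hfd : f.natDegree = q ^ A := by
    rw [hf, FiniteField.X_pow_card_pow_sub_X_natDegree_eq K (by omega) hc, Nat.card_eq_fintype_card]
  have hsq : Squarefree f := by
    apply Separable.squarefree
    apply galois_poly_separable 3
    have : Fact (Nat.Prime 3) := ⟨by norm_num⟩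
    obtain ⟨n, hn⟩ := FiniteField.card K 3
    rw [Nat.card_eq_fintype_card, hn.2]
    exact dvd_pow (dvd_pow_self 3 n.pos.ne') (by omega)
  have hnd := (squarefree_iff_nodup_normalizedFactors hf0).1 hsq
  set s := normalizedFactors f with hs
  have hM : MI s := nf_MI f
  have h1 : q ^ A = (s.map natDegree).sum := by
    rw [← natDegree_multiset_prod, ← hfd]
    · exact (natDegree_eq_of_degree_eq (degree_eq_degree_of_associated (prod_normalizedFactors hf0))).symm
    · intro h; exact (hM 0 h).2.ne_zero rfl
  have h2 : (s.map natDegree).sum = ∑ π ∈ s.toFinset, π.natDegree := by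
    rw [Finset.sum, Multiset.toFinset_val, hnd.dedup]
  have h3 : s.toFinset ⊆ Pr K A ∪ (Finset.range (A / 2 + 1)).biUnion (Pr K) := by
    intro π hπ
    rw [Multiset.mem_toFinset] at hπ
    have hd : π ∣ f := dvd_of_mem_normalizedFactors hπ
    have hdv := (hM π hπ).2.natDegree_dvd_of_dvd_X_pow_card_pow_sub_X hd
    rw [Finset.mem_union, Finset.mem_biUnion]
    obtain ⟨c, hc⟩ := hdv
    by_cases hc1 : c = 1
    · left; rw [mem_Pr]; exact ⟨hM π hπ, by rw [hc, hc1, mul_one]⟩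
    · right
      refine ⟨π.natDegree, ?_, mem_Pr.2 ⟨hM π hπ, rfl⟩⟩
      rw [Finset.mem_range]
      have : 2 ≤ c := by
        rcases c with _ | _ | c
        · omega
        · omega
        · omega
      have : π.natDegree * 2 ≤ A := by rw [hc]; exact Nat.mul_le_mul_left _ this
      omega
  have h4 : q ^ A ≤ A * (Pr K A).card + ∑ k ∈ Finset.range (A / 2 + 1), q ^ k := by
    rw [h1, h2]
    refine (Finset.sum_le_sum_of_subset h3).trans ?_
    refine (Finset.sum_union_inter (s₁ := Pr K A) (f := natDegree) ▸ Nat.le_add_right _ _).trans ?_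
    apply add_le_add
    · rw [Finset.sum_congr rfl (fun i hi => (mem_Pr.1 hi).2), Finset.sum_const, smul_eq_mul, mul_comm]
    · rw [Finset.sum_biUnion (by
        intro i _ j _ hij
        rw [Function.onFun, Finset.disjoint_left]
        intro π h1 h2
        exact hij ((mem_Pr.1 h1).2.symm.trans (mem_Pr.1 h2).2))]
      apply Finset.sum_le_sum
      intro k _
      rw [Finset.sum_congr rfl (fun i hi => (mem_Pr.1 hi).2), Finset.sum_const, smul_eq_mul, mul_comm]
      exact Pr_upper k
  have h5 := Nat.geomSum_lt (m := q) (n := A / 2 + 1) (s := Finset.range (A/2+1)) (by omega)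
    (fun k hk => Finset.mem_range.1 hk)
  have h6 : 2 * q ^ (A / 2 + 1) ≤ q ^ A := by
    calc 2 * q ^ (A/2+1) ≤ q * q ^ (A/2+1) := Nat.mul_le_mul_right _ (by omega)
      _ = q ^ (A/2+2) := by ring
      _ ≤ q ^ A := Nat.pow_le_pow_right (by omega) (by omega)
  omega

end Counts


section Bad
variable {K : Type} [Field K] [Fintype K]

lemma sum_transl {M : Type*} [AddCommMonoid M] {e : ℕ} {t : K[X]} (ht : t ∈ PL K e) (F : K[X] → M) (Q : K[X] → Prop) [DecidablePred Q]
    (hQ : ∀ h, Q (h + t) ↔ Q h) :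
    ∑ h ∈ (Mo K e).filter Q, F (h + t) = ∑ h ∈ (Mo K e).filter Q, F h := by
  apply Finset.sum_bij' (fun h _ => h + t) (fun h _ => h - t)
  · intro h hh
    rw [Finset.mem_filter] at *
    exact ⟨add_mem_Mo hh.1 ht, (hQ h).2 hh.2⟩
  · intro h hh
    rw [Finset.mem_filter] at *
    refine ⟨?_, (hQ _).1 (by simpa using hh.2)⟩
    rw [sub_eq_add_neg]
    apply add_mem_Mo hh.1
    have := sub_mem_PL (zero_mem_PL e) ht
    simpa using this
  · intro h _; simp
  · intro h _; simp
  · intro h _; simp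

lemma trans_count {ι : Type*} (e : ℕ) (I : Finset ι) (t : ι → K[X]) (ht : ∀ b ∈ I, t b ∈ PL K e)
    (B : K[X] → Prop) [DecidablePred B]
    (hB : ∀ h ∈ Mo K e, ∀ b ∈ I, ∀ c ∈ I, B (h + t b) → B (h + t c) → b = c) :
    ((Mo K e).filter B).card * I.card ≤ Fintype.card K ^ e := by
  have h1 : ∑ b ∈ I, ((Mo K e).filter B).card = ∑ b ∈ I, ∑ h ∈ Mo K e, if B (h + t b) then 1 else 0 := by
    apply Finset.sum_congr rfl
    intro b hb
    rw [Finset.card_filter]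
    have := sum_transl (ht b hb) (fun h => if B h then 1 else 0) (fun _ => True) (by simp)
    simp only [Finset.filter_true] at this
    exact this.symm
  rw [Finset.sum_const, smul_eq_mul, mul_comm] at h1
  rw [h1, Finset.sum_comm, ← card_Mo, Finset.card_eq_sum_ones]
  apply Finset.sum_le_sum
  intro h hh
  rw [← Finset.card_filter]
  apply Finset.card_le_one.2
  intro b hb c hc
  rw [Finset.mem_filter] at hb hc
  exact hB h hh b hb.1 c hc.1 hb.2 hc.2

lemma three_zero [CharP K 3] : (3 : K[X]) = 0 := by
  have := CharP.cast_eq_zero K[X] 3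
  exact_mod_cast this

lemma deriv_cube [CharP K 3] (g : K[X]) : derivative (g ^ 3) = 0 := by
  rw [derivative_pow]; simp [three_zero]
  left; left
  have := CharP.cast_eq_zero K 3
  exact_mod_cast this

lemma deriv_mul_cube [CharP K 3] (f g : K[X]) : derivative (f * g ^ 3) = derivative f * g ^ 3 := by
  rw [derivative_mul, deriv_cube, mul_zero, add_zero]

lemma sub_cube [CharP K 3] (a b : K[X]) : (a - b) ^ 3 = a ^ 3 - b ^ 3 := by
  have : Fact (Nat.Prime 3) := ⟨by norm_num⟩
  exact sub_pow_char (R := K[X]) (p := 3) a b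

lemma X_pow_cube_mem {e k i : ℕ} (hk : 3 * k + i ≤ e + 2) {b : K[X]} (hb : b ∈ PL K k) : X ^ i * b ^ 3 ∈ PL K e := by
  by_cases h0 : b = 0
  · rw [h0]; simpa using zero_mem_PL e
  · have := mem_PL_nat hb h0
    apply mem_PL_of_nat
    rw [natDegree_mul (pow_ne_zero _ X_ne_zero) (pow_ne_zero _ h0), natDegree_X_pow, natDegree_pow]
    omega

lemma bad_prime [CharP K 3] (e k : ℕ) (hk : 3 * k ≤ e) (π : K[X]) (hπ : π ∈ Pr K k) :
    ((Mo K e).filter (fun h => π ∣ derivative h)).card * Fintype.card K ^ k ≤ Fintype.card K ^ e := by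
  rw [← card_PL]
  obtain ⟨h1, h2⟩ := mem_Pr.1 hπ
  apply trans_count e (PL K k) (fun b => X ^ 1 * b ^ 3) (fun b hb => X_pow_cube_mem (by omega) hb)
  intro h hh b hb c hc d1 d2
  simp only [derivative_add, deriv_mul_cube, pow_one, derivative_X, one_mul] at d1 d2
  have d3 := dvd_sub d1 d2
  rw [add_sub_add_left_eq_sub, ← sub_cube] at d3
  have d4 := h1.2.prime.dvd_of_dvd_pow d3
  exact sub_eq_zero.1 (eq_zero_of_dvd_PL (sub_mem_PL hb hc) h2.ge d4)

lemma bad_cube [CharP K 3] (e k : ℕ) (hk : 3 * k ≤ e) (D : K[X]) (hD : D ∈ Mo K k) :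
    ((Mo K e).filter (fun h => D ^ 3 ∣ derivative h)).card * Fintype.card K ^ (2 * k) ≤ Fintype.card K ^ e := by
  obtain ⟨h1, h2⟩ := mem_Mo.1 hD
  have hc : Fintype.card K ^ (2 * k) = ((PL K k) ×ˢ (PL K k)).card := by
    rw [Finset.card_product, card_PL]; ring
  rw [hc]
  apply trans_count e _ (fun b => X ^ 1 * b.1 ^ 3 + X ^ 2 * b.2 ^ 3)
  · intro b hb
    rw [Finset.mem_product] at hb
    exact add_mem_PL (X_pow_cube_mem (by omega) hb.1) (X_pow_cube_mem (by omega) hb.2)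
  intro h hh b hb c hc d1 d2
  rw [Finset.mem_product] at hb hc
  simp only [derivative_add, deriv_mul_cube, pow_one, derivative_X, one_mul, derivative_X_pow] at d1 d2
  have d3 := dvd_sub d1 d2
  rw [add_sub_add_left_eq_sub] at d3
  have d4 : D ^ 3 ∣ (b.1 - c.1) ^ 3 + C (2:K) * X * (b.2 - c.2) ^ 3 := by
    rw [sub_cube, sub_cube]
    convert d3 using 1
    norm_num
    ring
  have cub : ∀ g : K[X], D ^ 3 ∣ g ^ 3 → g ∈ PL K k → g = 0 := by
    intro g hg hg'
    have := (UniqueFactorizationMonoid.pow_dvd_pow_iff_dvd (by norm_num : 3 ≠ 0)).1 hg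
    exact eq_zero_of_dvd_PL hg' h2.ge this
  have e2 : b.2 - c.2 = 0 := by
    apply cub _ _ (sub_mem_PL hb.2 hc.2)
    obtain ⟨m, hm⟩ := d4
    have := congrArg derivative hm
    rw [mul_comm (D ^ 3), deriv_mul_cube, derivative_add, deriv_cube, deriv_mul_cube, zero_add] at this
    simp only [derivative_mul, derivative_C, derivative_X, zero_mul, zero_add, mul_one] at this
    have h2' : (b.2 - c.2) ^ 3 = C (2⁻¹ : K) * (C 2 * (b.2 - c.2) ^ 3) := by
      rw [← mul_assoc, ← C_mul, inv_mul_cancel₀ two_ne, C_1, one_mul]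
    rw [h2', this]
    exact Dvd.intro_left (C 2⁻¹ * derivative m) (by ring)
  have e1 : b.1 - c.1 = 0 := by
    apply cub _ _ (sub_mem_PL hb.1 hc.1)
    rw [e2] at d4
    simpa using d4
  exact Prod.ext (sub_eq_zero.1 e1) (sub_eq_zero.1 e2)

lemma bad_deg [CharP K 3] (e t κ : ℕ) (hk : 3 * (t + κ) ≤ e) :
    ((Mo K e).filter (fun h => derivative h ∈ PL K (3 * t))).card * Fintype.card K ^ κ ≤ Fintype.card K ^ e := by
  rw [← card_PL]
  apply trans_count e (PL K κ) (fun b => X ^ 1 * (X ^ t * b) ^ 3)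
    (fun b hb => X_pow_cube_mem (by omega) (mul_mem_PL (a := t) (by simp) hb))
  intro h hh b hb c hc d1 d2
  simp only [derivative_add, deriv_mul_cube, pow_one, derivative_X, one_mul] at d1 d2
  have d3 := sub_mem_PL d1 d2
  rw [add_sub_add_left_eq_sub, ← sub_cube, ← mul_sub, mul_pow] at d3
  by_contra hne
  have h0 : b - c ≠ 0 := sub_ne_zero.2 hne
  have h1 : (X ^ t) ^ 3 * (b - c) ^ 3 ≠ 0 := mul_ne_zero (pow_ne_zero _ (pow_ne_zero _ X_ne_zero)) (pow_ne_zero _ h0)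
  have := mem_PL_nat d3 h1
  rw [natDegree_mul (pow_ne_zero _ (pow_ne_zero _ X_ne_zero)) (pow_ne_zero _ h0), natDegree_pow, natDegree_X_pow] at this
  omega

variable (K) in
noncomputable def small (κ : ℕ) : Finset K[X] := (Finset.range κ).biUnion (Pr K)

lemma mem_small {κ : ℕ} {π : K[X]} : π ∈ small K κ ↔ (π.Monic ∧ Irreducible π) ∧ π.natDegree < κ := by
  simp only [small, Finset.mem_biUnion, Finset.mem_range, mem_Pr]
  constructor
  · rintro ⟨k, hk, h1, rfl⟩; exact ⟨h1, hk⟩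
  · rintro ⟨h1, h2⟩; exact ⟨_, h2, h1, rfl⟩

noncomputable def smallSum (κ : ℕ) (h : K[X]) : ℕ := ∑ π ∈ (small K κ).filter (fun π => π ∣ derivative h), π.natDegree

lemma sum_smallSum [CharP K 3] (e κ : ℕ) (hκ : 3 * κ ≤ e) :
    ∑ h ∈ Mo K e, smallSum κ h ≤ κ * Fintype.card K ^ e := by
  unfold smallSum
  simp only [Finset.sum_filter]
  rw [Finset.sum_comm, small, Finset.sum_biUnion (by
        intro i _ j _ hij
        rw [Function.onFun, Finset.disjoint_left]
        intro π h1 h2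
        exact hij ((mem_Pr.1 h1).2.symm.trans (mem_Pr.1 h2).2))]
  have : ∀ k ∈ Finset.range κ, ∑ π ∈ Pr K k, ∑ h ∈ Mo K e, (if π ∣ derivative h then π.natDegree else 0) ≤ Fintype.card K ^ e := by
    intro k hk
    rw [Finset.mem_range] at hk
    have hpos : 0 < Fintype.card K ^ k := pow_pos Fintype.card_pos _
    apply Nat.le_of_mul_le_mul_left _ hpos
    rw [Finset.mul_sum]
    calc ∑ π ∈ Pr K k, Fintype.card K ^ k * ∑ h ∈ Mo K e, (if π ∣ derivative h then π.natDegree else 0)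
        ≤ ∑ π ∈ Pr K k, k * Fintype.card K ^ e := by
          apply Finset.sum_le_sum
          intro π hπ
          have := bad_prime e k (by omega) π hπ
          rw [← Finset.sum_filter, Finset.sum_const, (mem_Pr.1 hπ).2, smul_eq_mul]
          nlinarith
      _ = (k * (Pr K k).card) * Fintype.card K ^ e := by
          rw [Finset.sum_const, smul_eq_mul]; ring
      _ ≤ _ := Nat.mul_le_mul_right _ (Pr_upper k)
  refine (Finset.sum_le_sum this).trans ?_
  simp

def Good (e κ t : ℕ) (h : K[X]) : Prop :=
  6 * smallSum κ h ≤ e ∧ (∀ D : K[X], D.Monic → κ ≤ D.natDegree → ¬ D ^ 3 ∣ derivative h) ∧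
    derivative h ∉ PL K (3 * t)

lemma bad1 [CharP K 3] (e κ : ℕ) (hκ : 3 * κ ≤ e) :
    e * ((Mo K e).filter (fun h => ¬ 6 * smallSum κ h ≤ e)).card ≤ 6 * κ * Fintype.card K ^ e := by
  have h1 := sum_smallSum (K := K) e κ hκ
  calc e * ((Mo K e).filter (fun h => ¬ 6 * smallSum κ h ≤ e)).card
      = ∑ h ∈ (Mo K e).filter (fun h => ¬ 6 * smallSum κ h ≤ e), e := by
        rw [Finset.sum_const, smul_eq_mul, mul_comm]
    _ ≤ ∑ h ∈ (Mo K e).filter (fun h => ¬ 6 * smallSum κ h ≤ e), 6 * smallSum κ h := by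
        apply Finset.sum_le_sum
        intro h hh
        rw [Finset.mem_filter] at hh
        omega
    _ ≤ ∑ h ∈ Mo K e, 6 * smallSum κ h := Finset.sum_le_sum_of_subset (Finset.filter_subset _ _)
    _ = 6 * ∑ h ∈ Mo K e, smallSum κ h := by rw [Finset.mul_sum]
    _ ≤ _ := by nlinarith

lemma bad2 [CharP K 3] (e κ : ℕ) (hκ : 3 * κ ≤ e) :
    ((Mo K e).filter (fun h => ¬ (∀ D : K[X], D.Monic → κ ≤ D.natDegree → ¬ D ^ 3 ∣ derivative h))).card *
      Fintype.card K ^ κ ≤ (e + 1) * Fintype.card K ^ e := by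
  have hsub : (Mo K e).filter (fun h => ¬ (∀ D : K[X], D.Monic → κ ≤ D.natDegree → ¬ D ^ 3 ∣ derivative h)) ⊆
      (Finset.Icc κ (e / 3)).biUnion (fun k => (Mo K k).biUnion
        (fun D => (Mo K e).filter (fun h => D ^ 3 ∣ derivative h))) := by
    intro h hh
    rw [Finset.mem_filter] at hh
    obtain ⟨h1, h2⟩ := hh
    push Not at h2
    obtain ⟨D, hD, hDd, hdv⟩ := h2
    simp only [Finset.mem_biUnion, Finset.mem_Icc, Finset.mem_filter]
    by_cases h0 : derivative h = 0
    · refine ⟨κ, ⟨le_rfl, by omega⟩, X ^ κ, mem_Mo.2 ⟨monic_X_pow _, natDegree_X_pow _⟩, h1, ?_⟩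
      rw [h0]; exact dvd_zero _
    · refine ⟨D.natDegree, ⟨hDd, ?_⟩, D, mem_Mo.2 ⟨hD, rfl⟩, h1, hdv⟩
      have := natDegree_le_of_dvd hdv h0
      rw [natDegree_pow] at this
      have h3 := natDegree_derivative_le h
      rw [(mem_Mo.1 h1).2] at h3
      omega
  have hpos : 0 < Fintype.card K := Fintype.card_pos
  calc _ ≤ (∑ k ∈ Finset.Icc κ (e / 3), ∑ D ∈ Mo K k, ((Mo K e).filter (fun h => D ^ 3 ∣ derivative h)).card) * Fintype.card K ^ κ := by
        apply Nat.mul_le_mul_right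
        refine (Finset.card_le_card hsub).trans (Finset.card_biUnion_le.trans ?_)
        exact Finset.sum_le_sum (fun k _ => Finset.card_biUnion_le)
    _ = ∑ k ∈ Finset.Icc κ (e / 3), (∑ D ∈ Mo K k, ((Mo K e).filter (fun h => D ^ 3 ∣ derivative h)).card) * Fintype.card K ^ κ := by
        rw [Finset.sum_mul]
    _ ≤ ∑ k ∈ Finset.Icc κ (e / 3), Fintype.card K ^ e := by
        apply Finset.sum_le_sum
        intro k hk
        rw [Finset.mem_Icc] at hk
        have hp : 0 < Fintype.card K ^ k := pow_pos hpos _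
        apply Nat.le_of_mul_le_mul_left _ hp
        calc Fintype.card K ^ k * ((∑ D ∈ Mo K k, ((Mo K e).filter (fun h => D ^ 3 ∣ derivative h)).card) * Fintype.card K ^ κ)
            ≤ Fintype.card K ^ k * ((∑ D ∈ Mo K k, ((Mo K e).filter (fun h => D ^ 3 ∣ derivative h)).card) * Fintype.card K ^ k) := by
              gcongr
              · exact hk.1
          _ = ∑ D ∈ Mo K k, (((Mo K e).filter (fun h => D ^ 3 ∣ derivative h)).card * Fintype.card K ^ (2 * k)) := by
              rw [Finset.sum_mul, Finset.mul_sum]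
              apply Finset.sum_congr rfl
              intro D _
              ring
          _ ≤ ∑ D ∈ Mo K k, Fintype.card K ^ e := Finset.sum_le_sum (fun D hD => bad_cube e k (by omega) D hD)
          _ = _ := by rw [Finset.sum_const, smul_eq_mul, card_Mo]
    _ ≤ _ := by
        rw [Finset.sum_const, smul_eq_mul, Nat.card_Icc]
        apply Nat.mul_le_mul_right
        omega

lemma bad_total [CharP K 3] (e κ t : ℕ) (hκ : 3 * (t + κ) ≤ e) (he : 0 < e) :
    (((Mo K e).filter (fun h => ¬ Good e κ t h)).card : ℝ) ≤
      (6 * κ / e + (e + 2) / (Fintype.card K : ℝ) ^ κ) * (Fintype.card K : ℝ) ^ e := by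
  have h1 := bad1 (K := K) e κ (by omega)
  have h2 := bad2 (K := K) e κ (by omega)
  have h3 := bad_deg (K := K) e t κ hκ
  have hsub : (Mo K e).filter (fun h => ¬ Good e κ t h) ⊆
      ((Mo K e).filter (fun h => ¬ 6 * smallSum κ h ≤ e)) ∪
      (((Mo K e).filter (fun h => ¬ (∀ D : K[X], D.Monic → κ ≤ D.natDegree → ¬ D ^ 3 ∣ derivative h))) ∪
      ((Mo K e).filter (fun h => derivative h ∈ PL K (3 * t)))) := by
    intro h
    rw [Finset.mem_filter, Finset.mem_union, Finset.mem_union, Finset.mem_filter, Finset.mem_filter, Finset.mem_filter]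
    unfold Good
    tauto
  have h4 := (Finset.card_le_card hsub).trans ((Finset.card_union_le _ _).trans
    (Nat.add_le_add_left (Finset.card_union_le _ _) _))
  set b1 := ((Mo K e).filter (fun h => ¬ 6 * smallSum κ h ≤ e)).card
  set b2 := ((Mo K e).filter (fun h => ¬ (∀ D : K[X], D.Monic → κ ≤ D.natDegree → ¬ D ^ 3 ∣ derivative h))).card
  set b3 := ((Mo K e).filter (fun h => derivative h ∈ PL K (3 * t))).card
  have hq : (0 : ℝ) < Fintype.card K := by exact_mod_cast Fintype.card_pos
  have he' : (0 : ℝ) < e := by exact_mod_cast he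
  have hqk := pow_pos hq κ
  have h1' : (b1 : ℝ) ≤ 6 * κ / e * (Fintype.card K : ℝ) ^ e := by
    rw [div_mul_eq_mul_div, le_div_iff₀ he']
    have : ((e * b1 : ℕ) : ℝ) ≤ ((6 * κ * Fintype.card K ^ e : ℕ) : ℝ) := by exact_mod_cast h1
    push_cast at this
    linarith
  have h2' : (b2 : ℝ) ≤ (e + 1) / (Fintype.card K : ℝ) ^ κ * (Fintype.card K : ℝ) ^ e := by
    rw [div_mul_eq_mul_div, le_div_iff₀ hqk]
    exact_mod_cast h2
  have h3' : (b3 : ℝ) ≤ 1 / (Fintype.card K : ℝ) ^ κ * (Fintype.card K : ℝ) ^ e := by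
    rw [div_mul_eq_mul_div, le_div_iff₀ hqk, one_mul]
    exact_mod_cast h3
  have h4' : (((Mo K e).filter (fun h => ¬ Good e κ t h)).card : ℝ) ≤ b1 + (b2 + b3) := by exact_mod_cast h4
  refine h4'.trans ?_
  calc (b1 : ℝ) + (b2 + b3) ≤ _ := add_le_add h1' (add_le_add h2' h3')
    _ = _ := by ring

end Bad


section Diag

lemma diag_count {α : Type} (r : ℕ) (Y : Finset α) (y0 : α) (hy0 : y0 ∈ Y) :
    ((Fintype.piFinset (fun _ : Fin (2 * r) => Y)).filter
      (fun y => ∀ j0, Even ((Finset.univ.filter (fun j => y j = y j0)).card))).card ≤ r ^ (2 * r) * Y.card ^ r := by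
  have hsub : (Fintype.piFinset (fun _ : Fin (2 * r) => Y)).filter
      (fun y => ∀ j0, Even ((Finset.univ.filter (fun j => y j = y j0)).card)) ⊆
      ((Finset.univ : Finset (Fin (2 * r) → Fin r)) ×ˢ (Fintype.piFinset (fun _ : Fin r => Y))).image
        (fun ab => ab.2 ∘ ab.1) := by
    intro y hy
    rw [Finset.mem_filter, Fintype.mem_piFinset] at hy
    obtain ⟨hyY, hev⟩ := hy
    set img := Finset.univ.image y with himg
    have hcard : img.card ≤ r := by
      have h1 := Finset.card_eq_sum_card_image y (Finset.univ : Finset (Fin (2 * r)))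
      rw [Finset.card_univ, Fintype.card_fin] at h1
      have h2 : img.card * 2 ≤ ∑ b ∈ img, ((Finset.univ.filter (fun j => y j = b)).card) := by
        rw [← smul_eq_mul, ← Finset.sum_const]
        apply Finset.sum_le_sum
        intro b hb
        obtain ⟨j0, _, rfl⟩ := Finset.mem_image.1 hb
        have h3 := hev j0
        have h4 : 0 < (Finset.univ.filter (fun j => y j = y j0)).card :=
          Finset.card_pos.2 ⟨j0, by simp⟩
        obtain ⟨c, hc⟩ := h3
        omega
      have : ∑ b ∈ img, ((Finset.univ.filter (fun j => y j = b)).card) = 2 * r := h1.symm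
      omega
    rw [Finset.mem_image]
    have hmem : ∀ j, y j ∈ img := fun j => Finset.mem_image_of_mem _ (Finset.mem_univ _)
    refine ⟨(fun j => Fin.castLE hcard (img.equivFin ⟨y j, hmem j⟩),
      fun i => if h : (i : ℕ) < img.card then (img.equivFin.symm ⟨i, h⟩ : α) else y0), ?_, ?_⟩
    · rw [Finset.mem_product, Fintype.mem_piFinset]
      refine ⟨Finset.mem_univ _, ?_⟩
      intro i
      simp only
      split_ifs with h
      · have := (img.equivFin.symm ⟨i, h⟩).2
        obtain ⟨j, _, hj⟩ := Finset.mem_image.1 this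
        rw [← hj]; exact hyY j
      · exact hy0
    · funext j
      simp
  refine (Finset.card_le_card hsub).trans (Finset.card_image_le.trans ?_)
  rw [Finset.card_product, Fintype.card_piFinset]
  simp

end Diag

section Ring
variable {K : Type} [Field K] [Fintype K]
variable {ι : Type} [Fintype ι] (p : ι → K[X]) [hp : ∀ i, Fact (Irreducible (p i))] (ex : ι → ℕ)

abbrev EE := ∀ i, AdjoinRoot (p i)

noncomputable def emb : K[X] →+* EE p := RingHom.pi (fun i => AdjoinRoot.mk (p i))

lemma emb_apply (g : K[X]) (i : ι) : emb p g i = AdjoinRoot.mk (p i) g := rfl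

noncomputable def psi (v : EE p) : ℝ := ∏ i, ((quadraticChar (AdjoinRoot (p i)) (v i) : ℤ) : ℝ) ^ (ex i)

noncomputable def rho : ℕ := ∑ i, (p i).natDegree

lemma card_EE : Fintype.card (EE p) = Fintype.card K ^ (rho p) := by
  rw [Fintype.card_pi, rho, ← Finset.prod_pow_eq_pow_sum]
  exact Finset.prod_congr rfl (fun i _ => adj_card _)

lemma emb_inj (hm : ∀ i, (p i).Monic) (hinj : Function.Injective p) {n : ℕ} (hn : n ≤ rho p) {z : K[X]}
    (hz : z ∈ PL K n) (h : emb p z = 0) : z = 0 := by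
  have h1 : ∏ i, p i ∣ z := by
    apply prod_dvd_of_MI _ _ (fun i _ => ⟨hm i, (hp i).out⟩) (fun i _ j _ h => hinj h)
    intro i _
    rw [← AdjoinRoot.mk_eq_zero, ← emb_apply, h]; rfl
  apply eq_zero_of_dvd_PL hz _ h1
  rw [natDegree_prod_MI _ _ (fun i _ => hm i)]
  exact hn

lemma psi_mul (v w : EE p) : psi p ex (v * w) = psi p ex v * psi p ex w := by
  unfold psi
  rw [← Finset.prod_mul_distrib]
  apply Finset.prod_congr rfl
  intro i _
  rw [Pi.mul_apply, map_mul, Int.cast_mul, mul_pow]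

lemma qc_abs {E : Type} [Field E] [Fintype E] (a : E) : |((quadraticChar E a : ℤ) : ℝ)| ≤ 1 := by
  rcases qc_cases a with h | h | h <;> rw [h] <;> simp

lemma psi_abs (v : EE p) : |psi p ex v| ≤ 1 := by
  unfold psi
  rw [Finset.abs_prod]
  apply Finset.prod_le_one
  · intro i _; exact abs_nonneg _
  · intro i _; rw [abs_pow]; exact pow_le_one₀ (abs_nonneg _) (qc_abs _)

noncomputable def loc {n : ℕ} (y : Fin n → K[X]) (i : ι) : ℝ :=
  ∑ x : AdjoinRoot (p i), ∏ j, ((quadraticChar (AdjoinRoot (p i)) (x + AdjoinRoot.mk (p i) (y j)) : ℤ) : ℝ) ^ (ex i)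

lemma comp_eq {n : ℕ} (y : Fin n → K[X]) :
    ∑ v : EE p, ∏ j, psi p ex (v + emb p (y j)) = ∏ i, loc p ex y i := by
  unfold loc
  rw [Finset.prod_univ_sum, Fintype.piFinset_univ]
  apply Finset.sum_congr rfl
  intro v _
  unfold psi
  rw [Finset.prod_comm]
  rfl

lemma loc_triv {n : ℕ} (y : Fin n → K[X]) (i : ι) : |loc p ex y i| ≤ (Fintype.card K : ℝ) ^ (p i).natDegree := by
  unfold loc
  refine (Finset.abs_sum_le_sum_abs _ _).trans ?_
  refine (Finset.sum_le_sum (g := fun _ => (1:ℝ)) ?_).trans ?_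
  · intro x _
    rw [Finset.abs_prod]
    apply Finset.prod_le_one
    · intro i _; exact abs_nonneg _
    · intro i _; rw [abs_pow]; exact pow_le_one₀ (abs_nonneg _) (qc_abs _)
  · rw [Finset.sum_const, Finset.card_univ, adj_card]; simp

lemma not_sq_of_odd {E : Type} [Field E] (h : E[X]) (a : E) (ha : Odd (rootMultiplicity a h)) :
    ∀ p r : E[X], ∀ c : E, p ≠ 0 → p ^ 2 * h ≠ C c * r ^ 2 := by
  intro p r c hp heq
  have hh : h ≠ 0 := by
    rintro rfl; simp at ha
  have h0 : p ^ 2 * h ≠ 0 := mul_ne_zero (pow_ne_zero _ hp) hh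
  have h1 := congrArg (rootMultiplicity a) heq
  have h0' : C c * r ^ 2 ≠ 0 := heq ▸ h0
  rw [rootMultiplicity_mul h0, rootMultiplicity_mul h0', rootMultiplicity_C, sq, sq,
    rootMultiplicity_mul (by rw [← sq]; exact left_ne_zero_of_mul h0),
    rootMultiplicity_mul (by rw [← sq]; exact right_ne_zero_of_mul h0')] at h1
  obtain ⟨c, hc⟩ := ha
  omega

lemma loc_weil [CharP K 3] {n κ : ℕ} (y : Fin n → K[X]) (hy : ∀ j, y j ∈ PL K κ) (j0 : Fin n)
    (hodd : Odd ((Finset.univ.filter (fun j => y j = y j0)).card)) (i : ι) (hi : κ ≤ (p i).natDegree)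
    (he : ex i = 1) :
    loc p ex y i ^ 2 ≤ (3 * (8 * n + 12) ^ 2 : ℝ) * (Fintype.card K : ℝ) ^ (p i).natDegree := by
  set h : (AdjoinRoot (p i))[X] := ∏ j, (X - C (-(AdjoinRoot.mk (p i) (y j)))) with hh
  have hev : loc p ex y i = ((∑ x : (AdjoinRoot (p i)), quadraticChar (AdjoinRoot (p i)) (h.eval x) : ℤ) : ℝ) := by
    unfold loc
    push_cast
    apply Finset.sum_congr rfl
    intro x _
    rw [hh, eval_prod, map_prod]
    push_cast
    apply Finset.prod_congr rfl
    intro j _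
    rw [he, pow_one]
    rw [eval_sub, eval_X, eval_C, sub_neg_eq_add]
  have hns : ∀ g r : (AdjoinRoot (p i))[X], ∀ c : (AdjoinRoot (p i)), g ≠ 0 → g ^ 2 * h ≠ C c * r ^ 2 := by
    apply not_sq_of_odd h (-(AdjoinRoot.mk (p i) (y j0)))
    rw [← count_roots]
    have hr : h.roots = Finset.univ.val.map (fun j => -(AdjoinRoot.mk (p i) (y j))) := by
      have := roots_multiset_prod_X_sub_C (Multiset.map (fun j => -(AdjoinRoot.mk (p i) (y j))) Finset.univ.val)
      rw [Multiset.map_map] at this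
      exact this
    rw [hr, Multiset.count_map]
    convert hodd using 1
    rw [Finset.card_def, Finset.filter_val]
    congr 1
    apply Multiset.filter_congr
    intro j _
    rw [neg_inj]
    constructor
    · intro h
      have h2 := AdjoinRoot.mk_eq_mk.1 h.symm
      exact sub_eq_zero.1 (eq_zero_of_dvd_PL (sub_mem_PL (hy j) (hy j0)) hi h2)
    · intro h; rw [h]
  have hd : h.natDegree ≤ n := by
    rw [hh]
    refine (natDegree_prod_le _ _).trans ?_
    simp
  have : Fact (Nat.Prime 3) := ⟨by norm_num⟩
  obtain ⟨a, ha⟩ := FiniteField.card (AdjoinRoot (p i)) 3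
  have w := weil h hns n a hd ha.2
  have hc := adj_card (p i)
  rw [ha.2] at hc
  rw [hev]
  have w' : (((∑ x : (AdjoinRoot (p i)), quadraticChar (AdjoinRoot (p i)) (h.eval x)) ^ 2 : ℤ) : ℝ) ≤ ((3 * (8 * n + 12) ^ 2 * 3 ^ (a : ℕ) : ℤ) : ℝ) := by
    exact_mod_cast w
  rw [Int.cast_pow] at w'
  refine w'.trans (le_of_eq ?_)
  push_cast
  congr 1
  exact_mod_cast hc

lemma comp_bound [CharP K 3] {n κ : ℕ} (y : Fin n → K[X]) (hy : ∀ j, y j ∈ PL K κ) (j0 : Fin n)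
    (hodd : Odd ((Finset.univ.filter (fun j => y j = y j0)).card))
    (he : ∀ i, κ ≤ (p i).natDegree → ex i = 1) :
    (∏ i, loc p ex y i) ^ 2 ≤ (3 * (8 * n + 12) ^ 2 : ℝ) ^ (Finset.univ.filter (fun i => κ ≤ (p i).natDegree)).card *
      (Fintype.card K : ℝ) ^ (rho p + ∑ i ∈ Finset.univ.filter (fun i => ¬ κ ≤ (p i).natDegree), (p i).natDegree) := by
  rw [← Finset.prod_pow, rho, pow_add, ← Finset.prod_pow_eq_pow_sum, ← Finset.prod_pow_eq_pow_sum,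
    ← Finset.prod_const, Finset.prod_filter, Finset.prod_filter, ← Finset.prod_mul_distrib, ← Finset.prod_mul_distrib]
  apply Finset.prod_le_prod
  · intro i _; positivity
  · intro i _
    by_cases h : κ ≤ (p i).natDegree
    · simp only [h, if_true, not_true, if_false, mul_one]
      exact loc_weil p ex y hy j0 hodd i h (he i h)
    · simp only [h, if_false, not_false_iff, if_true, one_mul]
      rw [← sq, ← sq_abs]
      exact pow_le_pow_left₀ (abs_nonneg _) (loc_triv p ex y i) 2

noncomputable def WW (κ : ℕ) (v : EE p) : ℝ := ∑ y ∈ PL K κ, psi p ex (v + emb p y)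

lemma comp_triv {n : ℕ} (y : Fin n → K[X]) : |∏ i, loc p ex y i| ≤ (Fintype.card K : ℝ) ^ (rho p) := by
  rw [Finset.abs_prod, rho, ← Finset.prod_pow_eq_pow_sum]
  exact Finset.prod_le_prod (fun i _ => abs_nonneg _) (fun i _ => loc_triv p ex y i)

lemma moment [CharP K 3] (r κ : ℕ) (he : ∀ i, κ ≤ (p i).natDegree → ex i = 1) :
    ∑ v : EE p, WW p ex κ v ^ (2 * r) ≤
      (r : ℝ) ^ (2 * r) * ((Fintype.card K : ℝ) ^ κ) ^ r * (Fintype.card K : ℝ) ^ (rho p) +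
      ((Fintype.card K : ℝ) ^ κ) ^ (2 * r) *
      √((3 * (8 * (2 * r : ℕ) + 12) ^ 2 : ℝ) ^ (Finset.univ.filter (fun i => κ ≤ (p i).natDegree)).card *
      (Fintype.card K : ℝ) ^ (rho p + ∑ i ∈ Finset.univ.filter (fun i => ¬ κ ≤ (p i).natDegree), (p i).natDegree)) := by
  set B := √((3 * (8 * (2 * r : ℕ) + 12) ^ 2 : ℝ) ^ (Finset.univ.filter (fun i => κ ≤ (p i).natDegree)).card *
      (Fintype.card K : ℝ) ^ (rho p + ∑ i ∈ Finset.univ.filter (fun i => ¬ κ ≤ (p i).natDegree), (p i).natDegree)) with hB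
  have h1 : ∑ v : EE p, WW p ex κ v ^ (2 * r) =
      ∑ y ∈ Fintype.piFinset (fun _ : Fin (2 * r) => PL K κ), ∏ i, loc p ex y i := by
    simp only [← comp_eq]
    rw [Finset.sum_comm]
    apply Finset.sum_congr rfl
    intro v _
    rw [← Finset.prod_univ_sum (fun _ : Fin (2 * r) => PL K κ) (fun _ y => psi p ex (v + emb p y))]
    simp [WW]
  rw [h1, ← Finset.sum_filter_add_sum_filter_not _
    (fun y => ∀ j0, Even ((Finset.univ.filter (fun j => y j = y j0)).card))]
  have hB0 : 0 ≤ B := Real.sqrt_nonneg _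
  apply add_le_add
  · refine (Finset.sum_le_card_nsmul _ _ ((Fintype.card K : ℝ) ^ (rho p)) ?_).trans ?_
    · intro y _
      exact (le_abs_self _).trans (comp_triv p ex y)
    · rw [nsmul_eq_mul]
      apply mul_le_mul_of_nonneg_right _ (by positivity)
      have := diag_count r (PL K κ) 0 (zero_mem_PL κ)
      rw [card_PL] at this
      norm_cast
      convert this
  · refine (Finset.sum_le_card_nsmul _ _ B ?_).trans ?_
    · intro y hy
      rw [Finset.mem_filter, Fintype.mem_piFinset] at hy
      obtain ⟨hy1, hy2⟩ := hy
      push Not at hy2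
      obtain ⟨j0, hj0⟩ := hy2
      apply Real.le_sqrt_of_sq_le
      exact comp_bound p ex y hy1 j0 (Nat.not_even_iff_odd.1 hj0) he
    · rw [nsmul_eq_mul]
      apply mul_le_mul_of_nonneg_right _ hB0
      have : ((Fintype.piFinset (fun _ : Fin (2 * r) => PL K κ)).filter
        (fun y => ¬ ∀ j0, Even ((Finset.univ.filter (fun j => y j = y j0)).card))).card ≤
          (Fintype.card K ^ κ) ^ (2 * r) := by
        refine (Finset.card_filter_le _ _).trans ?_
        rw [Fintype.card_piFinset]
        simp [card_PL]
      exact_mod_cast this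

end Ring


section Burg
variable {K : Type} [Field K] [Fintype K]
variable {ι : Type} [Fintype ι] (p : ι → K[X]) [hp : ∀ i, Fact (Irreducible (p i))] (ex : ι → ℕ)

lemma emb_unit (hm : ∀ i, (p i).Monic) {x : K[X]} (hx : x.Monic) (hxi : Irreducible x) (hxp : ∀ i, p i ≠ x) :
    emb p x * (emb p x)⁻¹ = 1 := by
  funext i
  rw [Pi.mul_apply, Pi.inv_apply, Pi.one_apply]
  apply mul_inv_cancel₀
  rw [emb_apply, Ne, AdjoinRoot.mk_eq_zero]
  intro hd
  apply hxp i
  exact eq_of_monic_of_associated (hm i) hx ((hp i).out.associated_of_dvd hxi hd)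

lemma shift_id (hm : ∀ i, (p i).Monic) {A κ L : ℕ} (hL : A + κ = L) {x : K[X]} (hx : x.Monic)
    (hxi : Irreducible x) (hxp : ∀ i, p i ≠ x) (hxA : x.natDegree = A) (V : EE p) :
    (Fintype.card K : ℝ) ^ κ * ∑ s ∈ PL K L, psi p ex (V + emb p s) =
      ∑ s ∈ PL K L, psi p ex (emb p x) * WW p ex κ ((V + emb p s) * (emb p x)⁻¹) := by
  have hu := emb_unit p hm hx hxi hxp
  have h1 : ∀ y ∈ PL K κ, ∑ s ∈ PL K L, psi p ex (V + emb p s) =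
      ∑ s ∈ PL K L, psi p ex (emb p x) * psi p ex ((V + emb p s) * (emb p x)⁻¹ + emb p y) := by
    intro y hy
    have hxy : x * y ∈ PL K L := hL ▸ mul_mem_PL hxA.le hy
    have e1 : ∑ s ∈ PL K L, psi p ex (V + emb p s) = ∑ s ∈ PL K L, psi p ex (V + emb p (s + x * y)) := by
      symm
      apply Finset.sum_nbij' (fun s => s + x * y) (fun s => s - x * y)
      · intro s hs; exact add_mem_PL hs hxy
      · intro s hs; exact sub_mem_PL hs hxy
      · intro s _; simp
      · intro s _; simp
      · intro s _; rfl
    rw [e1]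
    apply Finset.sum_congr rfl
    intro s _
    rw [← psi_mul]
    congr 1
    rw [map_add, map_mul, mul_add]
    have : emb p x * ((V + emb p s) * (emb p x)⁻¹) = (V + emb p s) * (emb p x * (emb p x)⁻¹) := by ring
    rw [this, hu]; ring
  have h2 := Finset.sum_congr rfl h1
  rw [Finset.sum_const, card_PL, nsmul_eq_mul] at h2
  push_cast at h2
  rw [h2, Finset.sum_comm]
  apply Finset.sum_congr rfl
  intro s _
  rw [WW, Finset.mul_sum]

lemma pair_count (hm : ∀ i, (p i).Monic) (hinj : Function.Injective p) {A κ L : ℕ} (hL : A + κ = L)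
    (hAL : A + L ≤ rho p) {x1 x2 : K[X]}
    (h1 : x1.Monic) (h1i : Irreducible x1) (h1p : ∀ i, p i ≠ x1) (h1A : x1.natDegree = A)
    (h2 : x2.Monic) (h2i : Irreducible x2) (h2p : ∀ i, p i ≠ x2) (h2A : x2.natDegree = A) (hne : x1 ≠ x2) (V : EE p) :
    ((PL K L ×ˢ PL K L).filter (fun s => (V + emb p s.1) * (emb p x1)⁻¹ = (V + emb p s.2) * (emb p x2)⁻¹)).card
      ≤ Fintype.card K ^ κ := by
  set W := (PL K L ×ˢ PL K L).filter (fun s => (V + emb p s.1) * (emb p x1)⁻¹ = (V + emb p s.2) * (emb p x2)⁻¹) with hW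
  rcases W.eq_empty_or_nonempty with h | ⟨s0, hs0⟩
  · rw [h]; simp
  have hu1 := emb_unit p hm h1 h1i h1p
  have hu2 := emb_unit p hm h2 h2i h2p
  have key : ∀ s ∈ W, (V + emb p s.1) * emb p x2 = (V + emb p s.2) * emb p x1 := by
    intro s hs
    have := (Finset.mem_filter.1 hs).2
    calc (V + emb p s.1) * emb p x2 = (V + emb p s.1) * (emb p x2) * (emb p x1 * (emb p x1)⁻¹) := by rw [hu1, mul_one]
      _ = ((V + emb p s.1) * (emb p x1)⁻¹) * (emb p x1 * emb p x2) := by ring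
      _ = ((V + emb p s.2) * (emb p x2)⁻¹) * (emb p x1 * emb p x2) := by rw [this]
      _ = (V + emb p s.2) * emb p x1 * (emb p x2 * (emb p x2)⁻¹) := by ring
      _ = _ := by rw [hu2, mul_one]
  have hmem0 := Finset.mem_product.1 (Finset.mem_filter.1 hs0).1
  rw [← card_PL (K := K) κ]
  refine (Finset.card_le_card (t := (PL K κ).image (fun τ => (s0.1 + x1 * τ, s0.2 + x2 * τ))) ?_).trans Finset.card_image_le
  intro s hs
  have hmem := Finset.mem_product.1 (Finset.mem_filter.1 hs).1
  have hd1 := sub_mem_PL hmem.1 hmem0.1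
  have hd2 := sub_mem_PL hmem.2 hmem0.2
  have k1 := key s hs
  have k2 := key s0 hs0
  have hz : x2 * (s.1 - s0.1) - x1 * (s.2 - s0.2) = 0 := by
    apply emb_inj p hm hinj hAL
    · exact sub_mem_PL (mul_mem_PL h2A.le hd1) (mul_mem_PL h1A.le hd2)
    · simp only [map_sub, map_mul]
      linear_combination k1 - k2
  have hco : IsCoprime x1 x2 := by
    rcases EuclideanDomain.dvd_or_coprime x1 x2 h1i with h | h
    · exact absurd (eq_of_monic_of_associated h1 h2 (h1i.associated_of_dvd h2i h)) hne
    · exact h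
  have hdv : x1 ∣ s.1 - s0.1 := by
    apply hco.dvd_of_dvd_mul_left
    exact ⟨s.2 - s0.2, sub_eq_zero.1 hz⟩
  obtain ⟨τ, hτ⟩ := hdv
  have hτ2 : s.2 - s0.2 = x2 * τ := by
    apply mul_left_cancel₀ h1.ne_zero
    rw [hτ] at hz
    linear_combination -hz
  rw [Finset.mem_image]
  refine ⟨τ, ?_, ?_⟩
  · rw [mem_PL]
    rw [mem_PL, hτ, degree_mul, degree_eq_natDegree h1.ne_zero, h1A, ← hL] at hd1
    by_cases h0 : τ = 0
    · rw [h0, degree_zero]; exact WithBot.bot_lt_coe _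
    · rw [degree_eq_natDegree h0] at hd1 ⊢
      norm_cast at hd1 ⊢
      omega
  · rw [← hτ, ← hτ2]; simp

lemma nu_count (hm : ∀ i, (p i).Monic) (hinj : Function.Injective p) {A κ L : ℕ} (hL : A + κ = L)
    (hAL : A + L ≤ rho p) (XX : Finset K[X])
    (hX : ∀ x ∈ XX, x.Monic ∧ Irreducible x ∧ (∀ i, p i ≠ x) ∧ x.natDegree = A) (V : EE p) :
    ∑ v : EE p, (((XX ×ˢ PL K L).filter (fun z => (V + emb p z.2) * (emb p z.1)⁻¹ = v)).card) ^ 2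
     ≤ XX.card ^ 2 * Fintype.card K ^ κ + XX.card * Fintype.card K ^ L := by
  set φ : K[X] × K[X] → EE p := fun z => (V + emb p z.2) * (emb p z.1)⁻¹ with hφ
  have e1 : ∑ v : EE p, (((XX ×ˢ PL K L).filter (fun z => φ z = v)).card) ^ 2 =
      ∑ z ∈ XX ×ˢ PL K L, ((XX ×ˢ PL K L).filter (fun w => φ w = φ z)).card := by
    rw [← Finset.sum_fiberwise (XX ×ˢ PL K L) φ]
    apply Finset.sum_congr rfl
    intro v _
    rw [Finset.sum_congr rfl (g := fun _ => ((XX ×ˢ PL K L).filter (fun z => φ z = v)).card)]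
    · rw [Finset.sum_const, smul_eq_mul, sq]
    · intro z hz
      rw [(Finset.mem_filter.1 hz).2]
  have e2 : ∑ z ∈ XX ×ˢ PL K L, ((XX ×ˢ PL K L).filter (fun w => φ w = φ z)).card =
      ∑ x ∈ XX, ∑ x' ∈ XX, ((PL K L ×ˢ PL K L).filter (fun s => φ (x', s.2) = φ (x, s.1))).card := by
    simp only [Finset.card_filter, Finset.sum_product]
    apply Finset.sum_congr rfl
    intro x _
    rw [Finset.sum_comm]
  rw [e1, e2]
  have e3 : ∀ x ∈ XX, ∑ x' ∈ XX, ((PL K L ×ˢ PL K L).filter (fun s => φ (x', s.2) = φ (x, s.1))).card ≤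
      XX.card * Fintype.card K ^ κ + Fintype.card K ^ L := by
    intro x hx
    have : ∀ x' ∈ XX, ((PL K L ×ˢ PL K L).filter (fun s => φ (x', s.2) = φ (x, s.1))).card ≤
        Fintype.card K ^ κ + if x' = x then Fintype.card K ^ L else 0 := by
      intro x' hx'
      obtain ⟨a1, a2, a3, a4⟩ := hX x hx
      obtain ⟨b1, b2, b3, b4⟩ := hX x' hx'
      by_cases h : x' = x
      · subst h
        rw [if_pos rfl]
        refine le_trans ?_ (Nat.le_add_left _ _)
        rw [← card_PL (K := K) L]
        refine (Finset.card_le_card (t := (PL K L).image (fun s => (s, s))) ?_).trans Finset.card_image_le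
        intro s hs
        have hmem := Finset.mem_product.1 (Finset.mem_filter.1 hs).1
        have hh := (Finset.mem_filter.1 hs).2
        simp only [hφ] at hh
        have hu := emb_unit p hm a1 a2 a3
        have h3 : V + emb p s.2 = V + emb p s.1 := by
          calc V + emb p s.2 = (V + emb p s.2) * (emb p x')⁻¹ * emb p x' := by rw [mul_assoc, mul_comm _ (emb p x'), hu, mul_one]
            _ = (V + emb p s.1) * (emb p x')⁻¹ * emb p x' := by rw [hh]
            _ = _ := by rw [mul_assoc, mul_comm _ (emb p x'), hu, mul_one]
        have h4 : s.2 - s.1 = 0 := by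
          apply emb_inj p hm hinj (n := L) (by omega) (sub_mem_PL hmem.2 hmem.1)
          rw [map_sub, sub_eq_zero]
          exact add_left_cancel h3
        rw [Finset.mem_image]
        exact ⟨s.1, hmem.1, Prod.ext rfl (sub_eq_zero.1 h4).symm⟩
      · rw [if_neg h, add_zero]
        refine le_trans (le_of_eq ?_) (pair_count p hm hinj hL hAL a1 a2 a3 a4 b1 b2 b3 b4 (Ne.symm h) V)
        congr 1
        apply Finset.filter_congr
        intro s _
        exact eq_comm
    refine (Finset.sum_le_sum this).trans ?_
    rw [Finset.sum_add_distrib, Finset.sum_const, smul_eq_mul, Finset.sum_ite_eq' , if_pos hx]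
  refine (Finset.sum_le_sum e3).trans ?_
  rw [Finset.sum_const, smul_eq_mul]
  apply le_of_eq; ring

lemma burgess (hm : ∀ i, (p i).Monic) (hinj : Function.Injective p) {A κ L : ℕ} (hL : A + κ = L)
    (hAL : A + L ≤ rho p) (XX : Finset K[X])
    (hX : ∀ x ∈ XX, x.Monic ∧ Irreducible x ∧ (∀ i, p i ≠ x) ∧ x.natDegree = A) (hne : XX.Nonempty) (V : EE p) (n : ℕ) :
    ((XX.card : ℝ) * ((Fintype.card K : ℝ) ^ κ * |∑ s ∈ PL K L, psi p ex (V + emb p s)|)) ^ (2 * (n + 1)) ≤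
      ((XX.card : ℝ) * (Fintype.card K : ℝ) ^ L) ^ (2 * n) *
      ((XX.card : ℝ) ^ 2 * (Fintype.card K : ℝ) ^ κ + XX.card * (Fintype.card K : ℝ) ^ L) *
      ∑ v : EE p, WW p ex κ v ^ (2 * (n + 1)) := by
  set φ : K[X] × K[X] → EE p := fun z => (V + emb p z.2) * (emb p z.1)⁻¹ with hφ
  set Z := XX ×ˢ PL K L with hZ
  have hZc : (Z.card : ℝ) = (XX.card : ℝ) * (Fintype.card K : ℝ) ^ L := by
    rw [hZ, Finset.card_product, card_PL]; push_cast; rfl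
  set T := ∑ z ∈ Z, |WW p ex κ (φ z)| with hT
  have h1 : (XX.card : ℝ) * ((Fintype.card K : ℝ) ^ κ * |∑ s ∈ PL K L, psi p ex (V + emb p s)|) ≤ T := by
    rw [hT, hZ, Finset.sum_product, ← nsmul_eq_mul]
    apply Finset.card_nsmul_le_sum
    intro x hx
    obtain ⟨a1, a2, a3, a4⟩ := hX x hx
    have := shift_id p ex hm hL a1 a2 a3 a4 V
    have h2 : (Fintype.card K : ℝ) ^ κ * |∑ s ∈ PL K L, psi p ex (V + emb p s)| =
      |(Fintype.card K : ℝ) ^ κ * ∑ s ∈ PL K L, psi p ex (V + emb p s)| := by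
      rw [abs_mul, abs_of_nonneg (by positivity : (0:ℝ) ≤ (Fintype.card K : ℝ) ^ κ)]
    rw [h2, this]
    refine (Finset.abs_sum_le_sum_abs _ _).trans ?_
    apply Finset.sum_le_sum
    intro s _
    rw [abs_mul]
    exact mul_le_of_le_one_left (abs_nonneg _) (psi_abs _ _ _)
  have hT0 : 0 ≤ T := Finset.sum_nonneg (fun _ _ => abs_nonneg _)
  refine (pow_le_pow_left₀ (by positivity) h1 _).trans ?_
  have hZpos : (0:ℝ) < Z.card := by
    rw [hZc]
    have : 0 < XX.card := hne.card_pos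
    have : 0 < Fintype.card K := Fintype.card_pos
    positivity
  have h3 : T ^ (n + 1) ≤ (Z.card : ℝ) ^ n * ∑ z ∈ Z, |WW p ex κ (φ z)| ^ (n + 1) := by
    have := pow_sum_div_card_le_sum_pow (s := Z) (f := fun z => |WW p ex κ (φ z)|) (fun _ _ => abs_nonneg _) n
    rw [div_le_iff₀ (by positivity)] at this
    rw [mul_comm]; exact this
  set ν : EE p → ℕ := fun v => (Z.filter (fun z => φ z = v)).card with hν
  have h4 : ∑ z ∈ Z, |WW p ex κ (φ z)| ^ (n + 1) = ∑ v : EE p, (ν v : ℝ) * |WW p ex κ v| ^ (n + 1) := by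
    rw [← Finset.sum_fiberwise Z φ]
    apply Finset.sum_congr rfl
    intro v _
    rw [Finset.sum_congr rfl (g := fun _ => |WW p ex κ v| ^ (n + 1))]
    · rw [Finset.sum_const, nsmul_eq_mul]
    · intro z hz
      rw [(Finset.mem_filter.1 hz).2]
  have h5 := Finset.sum_mul_sq_le_sq_mul_sq Finset.univ (fun v => (ν v : ℝ)) (fun v : EE p => |WW p ex κ v| ^ (n + 1))
  have h6 : ∑ v : EE p, (|WW p ex κ v| ^ (n + 1)) ^ 2 = ∑ v : EE p, WW p ex κ v ^ (2 * (n + 1)) := by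
    apply Finset.sum_congr rfl
    intro v _
    rw [← pow_mul, mul_comm (n+1) 2, pow_mul, sq_abs, ← pow_mul]
  have h7 : ∑ v : EE p, ((ν v : ℝ)) ^ 2 ≤ ((XX.card : ℝ) ^ 2 * (Fintype.card K : ℝ) ^ κ + XX.card * (Fintype.card K : ℝ) ^ L) := by
    have := nu_count p hm hinj hL hAL XX hX V
    exact_mod_cast this
  calc T ^ (2 * (n + 1)) = (T ^ (n + 1)) ^ 2 := by rw [← pow_mul, mul_comm]
    _ ≤ ((Z.card : ℝ) ^ n * ∑ z ∈ Z, |WW p ex κ (φ z)| ^ (n + 1)) ^ 2 := pow_le_pow_left₀ (by positivity) h3 2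
    _ = (Z.card : ℝ) ^ (2 * n) * (∑ v : EE p, (ν v : ℝ) * |WW p ex κ v| ^ (n + 1)) ^ 2 := by
      rw [h4, mul_pow, ← pow_mul, mul_comm n 2]
    _ ≤ (Z.card : ℝ) ^ (2 * n) * (((XX.card : ℝ) ^ 2 * (Fintype.card K : ℝ) ^ κ + XX.card * (Fintype.card K : ℝ) ^ L) *
      ∑ v : EE p, WW p ex κ v ^ (2 * (n + 1))) := by
      apply mul_le_mul_of_nonneg_left _ (by positivity)
      rw [← h6]
      refine h5.trans ?_
      exact mul_le_mul_of_nonneg_right h7 (Finset.sum_nonneg (fun _ _ => by positivity))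
    _ = _ := by rw [← hZc, mul_assoc]

end Burg


section Struct
variable {K : Type} [Field K] [Fintype K]
open UniqueFactorizationMonoid

lemma third_deriv [CharP K 3] (h : K[X]) : derivative (derivative (derivative h)) = 0 := by
  have h1 : derivative^[3] h = 0 := by
    have h2 := congrFun (factorial_smul_hasseDeriv (R := K) 3) h
    rw [← h2]
    have : (Nat.factorial 3) • (hasseDeriv 3 h) = ((3 : K[X]) * 2) * hasseDeriv 3 h := by
      rw [nsmul_eq_mul]; norm_num [Nat.factorial]
    simp only [LinearMap.smul_apply]
    rw [this, three_zero, zero_mul, zero_mul]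
  exact h1

lemma vcount {g π : K[X]} (hg : g ≠ 0) (hm : π.Monic) (hi : Irreducible π) :
    ∃ u, g = π ^ ((normalizedFactors g).count π) * u ∧ ¬ π ∣ u := by
  have h1 := emultiplicity_eq_count_normalizedFactors hi hg
  rw [hm.normalize_eq_self] at h1
  obtain ⟨⟨u, hu⟩, h3⟩ := emultiplicity_eq_coe.1 h1
  refine ⟨u, hu, ?_⟩
  rintro ⟨w, rfl⟩
  apply h3
  exact ⟨w, by rw [pow_succ, mul_assoc]; exact hu⟩

lemma vmod [CharP K 3] {g π : K[X]} (hg : g ≠ 0) (hgd : derivative (derivative g) = 0) (hm : π.Monic) (hi : Irreducible π) :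
    (normalizedFactors g).count π % 3 ≠ 2 := by
  obtain ⟨u, hu, hnd⟩ := vcount hg hm hi
  intro hv
  set v := (normalizedFactors g).count π
  have hg2 : g = (π * π * u) * (π ^ (v / 3)) ^ 3 := by
    have : v = v / 3 * 3 + 2 := by omega
    conv_lhs => rw [hu, this, pow_add, pow_mul]
    ring
  rw [hg2, deriv_mul_cube, deriv_mul_cube] at hgd
  have h1 := (mul_eq_zero.1 hgd).resolve_right (pow_ne_zero _ (pow_ne_zero _ hm.ne_zero))
  simp only [derivative_mul, derivative_add] at h1
  have h2 : π ∣ derivative π * (derivative π * u) := by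
    refine ⟨2 * derivative (derivative π) * u + 4 * derivative π * derivative u + π * derivative (derivative u), ?_⟩
    linear_combination (-1) * h1 + derivative π * derivative π * u * three_zero (K := K)
  have hnd2 : ¬ π ∣ derivative π := by
    intro hd
    have hs : IsCoprime π (derivative π) := PerfectField.separable_of_irreducible hi
    exact hi.not_isUnit (hs.isUnit_of_dvd' dvd_rfl hd)
  rcases hi.prime.dvd_or_dvd h2 with h | h
  · exact hnd2 h
  rcases hi.prime.dvd_or_dvd h with h | h
  · exact hnd2 h
  · exact hnd h

lemma deg_eq {g : K[X]} (hg : g ≠ 0) :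
    g.natDegree = ∑ π ∈ (normalizedFactors g).toFinset, (normalizedFactors g).count π * π.natDegree := by
  have h1 : g.natDegree = ((normalizedFactors g).prod).natDegree :=
    natDegree_eq_of_degree_eq (degree_eq_degree_of_associated (prod_normalizedFactors hg).symm)
  rw [h1, natDegree_multiset_prod_of_monic _ (fun π hπ => (nf_MI g π hπ).1), Finset.sum_multiset_map_count]
  rfl

lemma cube_dvd {g : K[X]} (hg : g ≠ 0) :
    (∏ π ∈ (normalizedFactors g).toFinset, π ^ ((normalizedFactors g).count π / 3)) ^ 3 ∣ g := by
  have h1 : (normalizedFactors g).prod ∣ g := (prod_normalizedFactors hg).dvd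
  refine dvd_trans ?_ h1
  rw [Finset.prod_multiset_count, ← Finset.prod_pow]
  apply Finset.prod_dvd_prod_of_dvd
  intro π _
  rw [← pow_mul]
  exact pow_dvd_pow _ (by omega)

lemma good_struct [CharP K 3] {e κ t : ℕ} {h : K[X]} (hh : h ∈ Mo K e) (hG : Good e κ t h) :
    derivative h ≠ 0 ∧ (derivative h).natDegree ≤ e ∧
    3 * t ≤ 3 * κ + ∑ π ∈ (normalizedFactors (derivative h)).toFinset, π.natDegree ∧
    (∀ π ∈ (normalizedFactors (derivative h)).toFinset, κ ≤ π.natDegree → (normalizedFactors (derivative h)).count π = 1) ∧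
    ∑ π ∈ (normalizedFactors (derivative h)).toFinset, π.natDegree ≤ e ∧
    6 * ∑ π ∈ ((normalizedFactors (derivative h)).toFinset).filter (fun π => ¬ κ ≤ π.natDegree), π.natDegree ≤ e := by
  obtain ⟨g1, g2, g3⟩ := hG
  set g := derivative h with hg
  have hg0 : g ≠ 0 := fun h0 => g3 (by rw [h0]; exact zero_mem_PL _)
  have hdeg : g.natDegree ≤ e := by
    rw [mem_Mo] at hh
    rw [← hh.2]
    exact (natDegree_derivative_le h).trans (Nat.sub_le _ _)
  have hgd : derivative (derivative g) = 0 := third_deriv h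
  have hMI : ∀ π ∈ (normalizedFactors g).toFinset, π.Monic ∧ Irreducible π :=
    fun π hπ => nf_MI g π (Multiset.mem_toFinset.1 hπ)
  have hpos : ∀ π ∈ (normalizedFactors g).toFinset, 1 ≤ (normalizedFactors g).count π :=
    fun π hπ => Multiset.one_le_count_iff_mem.2 (Multiset.mem_toFinset.1 hπ)
  have hde := deg_eq hg0
  refine ⟨hg0, hdeg, ?_, ?_, ?_, ?_⟩
  · set D := ∏ π ∈ (normalizedFactors g).toFinset, π ^ ((normalizedFactors g).count π / 3) with hD
    have hDm : D.Monic := monic_prod_of_monic _ _ (fun π hπ => (hMI π hπ).1.pow _)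
    have hDk : D.natDegree < κ := by
      by_contra hc
      exact g2 D hDm (by omega) (cube_dvd hg0)
    have hDd : D.natDegree = ∑ π ∈ (normalizedFactors g).toFinset, (normalizedFactors g).count π / 3 * π.natDegree := by
      rw [hD, natDegree_prod_of_monic _ _ (fun π hπ => (hMI π hπ).1.pow _)]
      exact Finset.sum_congr rfl (fun π _ => natDegree_pow _ _)
    have h3 : 3 * t ≤ g.natDegree := by
      by_contra hc
      exact g3 (mem_PL_of_nat (by omega))
    have h4 : g.natDegree ≤ 3 * D.natDegree + ∑ π ∈ (normalizedFactors g).toFinset, π.natDegree := by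
      rw [hde, hDd, Finset.mul_sum, ← Finset.sum_add_distrib]
      apply Finset.sum_le_sum
      intro π hπ
      have := vmod hg0 hgd (hMI π hπ).1 (hMI π hπ).2
      set v := (normalizedFactors g).count π
      have hv : v ≤ 3 * (v / 3) + 1 := by omega
      calc v * π.natDegree ≤ (3 * (v / 3) + 1) * π.natDegree := Nat.mul_le_mul_right _ hv
        _ = _ := by ring
    omega
  · intro π hπ hk
    have h1 := vmod hg0 hgd (hMI π hπ).1 (hMI π hπ).2
    have h2 := hpos π hπ
    have h3 : ¬ 3 ≤ (normalizedFactors g).count π := by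
      intro h3
      obtain ⟨u, hu, _⟩ := vcount hg0 (hMI π hπ).1 (hMI π hπ).2
      apply g2 π (hMI π hπ).1 hk
      refine (pow_dvd_pow π h3).trans ⟨u, hu⟩
    omega
  · refine le_trans ?_ (hde.symm.le.trans hdeg)
    apply Finset.sum_le_sum
    intro π hπ
    exact Nat.le_mul_of_pos_left _ (hpos π hπ)
  · refine le_trans (Nat.mul_le_mul_left 6 ?_) g1
    unfold smallSum
    apply Finset.sum_le_sum_of_subset
    intro π hπ
    rw [Finset.mem_filter] at hπ ⊢
    rw [mem_small]
    exact ⟨⟨hMI π hπ.1, by omega⟩, dvd_of_mem_normalizedFactors (Multiset.mem_toFinset.1 hπ.1)⟩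

end Struct

section Char
variable {K : Type} [Field K] [Fintype K]
open UniqueFactorizationMonoid

abbrev Idx (P g : K[X]) : Type := {π : K[X] // π ∈ (normalizedFactors g).toFinset.erase P}

noncomputable def pp (P g : K[X]) : Idx P g → K[X] := fun i => i.1

noncomputable def pex (P g : K[X]) : Idx P g → ℕ := fun i => (normalizedFactors g).count i.1

lemma pp_MI (P g : K[X]) (i : Idx P g) : (pp P g i).Monic ∧ Irreducible (pp P g i) :=
  nf_MI g _ (Multiset.mem_toFinset.1 (Finset.mem_of_mem_erase i.2))

instance ppFact (P g : K[X]) (i : Idx P g) : Fact (Irreducible (pp P g i)) := ⟨(pp_MI P g i).2⟩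

lemma JJ_psi (P g : K[X]) (hirr : Irreducible P) (f : K[X]) (hf : P ∣ f - 1) :
    ((JJ (normalizedFactors g) f : ℤ) : ℝ) = psi (pp P g) (pex P g) (emb (pp P g) f) := by
  rw [JJ, Finset.prod_multiset_map_count]
  have h1 : qs P f = 1 := by rw [qs_congr P f 1 hirr hf, qs_one P hirr]
  have h2 : ∏ π ∈ (normalizedFactors g).toFinset, qs π f ^ ((normalizedFactors g).count π) =
      ∏ π ∈ (normalizedFactors g).toFinset.erase P, qs π f ^ ((normalizedFactors g).count π) := by
    by_cases hP : P ∈ (normalizedFactors g).toFinset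
    · rw [← Finset.mul_prod_erase _ _ hP, h1, one_pow, one_mul]
    · rw [Finset.erase_eq_of_notMem hP]
  rw [h2, ← Finset.prod_coe_sort, psi]
  push_cast
  apply Finset.prod_congr rfl
  intro i _
  rw [emb_apply, ← qs_eq]
  rfl

lemma cube_add [CharP K 3] {ι : Type} [Fintype ι] (p : ι → K[X]) [hp : ∀ i, Fact (Irreducible (p i))] (x y : EE p) :
    (x + y) ^ 3 = x ^ 3 + y ^ 3 := by
  have h3 : (3 : EE p) = 0 := by
    have := congrArg (emb p) (three_zero (K := K))
    rw [map_zero, map_ofNat] at this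
    exact this
  linear_combination (x ^ 2 * y + x * y ^ 2) * h3

lemma cube_surj [CharP K 3] {ι : Type} [Fintype ι] (p : ι → K[X]) [hp : ∀ i, Fact (Irreducible (p i))] (x : EE p) :
    ∃ u : EE p, u ^ 3 = x := by
  have : Fact (Nat.Prime 3) := ⟨by norm_num⟩
  have : ∀ i, ∃ u : AdjoinRoot (p i), u ^ 3 = x i := by
    intro i
    have hb := bijective_frobenius (AdjoinRoot (p i)) 3
    obtain ⟨u, hu⟩ := hb.2 (x i)
    exact ⟨u, by rw [← hu, frobenius_def]⟩
  choose u hu using this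
  exact ⟨u, funext hu⟩

lemma psi_cube {ι : Type} [Fintype ι] (p : ι → K[X]) [hp : ∀ i, Fact (Irreducible (p i))] (ex : ι → ℕ) (x : EE p) :
    psi p ex (x ^ 3) = psi p ex x := by
  unfold psi
  apply Finset.prod_congr rfl
  intro i _
  rw [Pi.pow_apply, map_pow]
  congr 1
  rcases qc_cases (x i) with h | h | h <;> rw [h] <;> norm_num

lemma char_sum [CharP K 3] (P : K[X]) (hP : P.Monic) (hirr : Irreducible P) (m e L : ℕ) (h : K[X]) (hh : h ∈ Mo K e)
    (h0 : derivative h ≠ 0) (hd : P ∣ P ^ (3 * m) * h) (hL : 3 * (P.natDegree + L) ≤ e + 2) :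
    ∃ V : EE (pp P (derivative h)),
      |∑ s ∈ PL K L, (pmu (1 + P ^ (3 * m) * (h + (P * s) ^ 3)) : ℝ)| ≤
      |∑ s ∈ PL K L, psi (pp P (derivative h)) (pex P (derivative h)) (V + emb _ s)| := by
  set g := derivative h with hg
  obtain ⟨u, hu⟩ := cube_surj (pp P g) (emb (pp P g) (1 + P ^ (3 * m) * h))
  obtain ⟨ε, hε, hA⟩ := claimA P hP hirr (3 * m * P.natDegree + e) m g h0
  have hunit : emb (pp P g) (P ^ (m + 1)) * (emb (pp P g) (P ^ (m + 1)))⁻¹ = 1 := by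
    have h1 := emb_unit (pp P g) (fun i => (pp_MI P g i).1) hP hirr (fun i => Finset.ne_of_mem_erase i.2)
    funext i
    have h2 := congrFun h1 i
    rw [Pi.mul_apply, Pi.inv_apply, Pi.one_apply] at h2 ⊢
    apply mul_inv_cancel₀
    rw [map_pow, Pi.pow_apply]
    apply pow_ne_zero
    intro h3
    rw [h3, zero_mul] at h2
    exact zero_ne_one h2
  set w := emb (pp P g) (P ^ (m + 1)) with hw
  refine ⟨u * w⁻¹, ?_⟩
  have key : ∀ s ∈ PL K L, (pmu (1 + P ^ (3 * m) * (h + (P * s) ^ 3)) : ℝ) =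
      (ε * psi (pp P g) (pex P g) w) * psi (pp P g) (pex P g) (u * w⁻¹ + emb _ s) := by
    intro s hs
    set f := 1 + P ^ (3 * m) * (h + (P * s) ^ 3) with hf
    have hcm : (P * s) ^ 3 ∈ PL K e := by
      have h1 : P * s ∈ PL K (P.natDegree + L) := mul_mem_PL le_rfl hs
      have h2 := X_pow_cube_mem (e := e) (k := P.natDegree + L) (i := 0) (by omega) h1
      simpa using h2
    have hMo := add_mem_Mo hh hcm
    have hPd : P ∣ f - 1 := by
      have : f - 1 = P ^ (3 * m) * h + P * (P ^ (3 * m) * (P ^ 2 * s ^ 3)) := by rw [hf]; ring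
      rw [this]
      exact dvd_add hd (dvd_mul_right _ _)
    rw [mem_Mo] at hMo
    have hmm : (P ^ (3 * m) * (h + (P * s) ^ 3)).Monic := (hP.pow _).mul hMo.1
    have hnd : (P ^ (3 * m) * (h + (P * s) ^ 3)).natDegree = 3 * m * P.natDegree + e := by
      rw [(hP.pow _).natDegree_mul hMo.1, hP.natDegree_pow, hMo.2]
    have hpos : 0 < (P ^ (3 * m) * (h + (P * s) ^ 3)).natDegree := by
      rw [hnd]
      have := hirr.natDegree_pos
      omega
    have hlt : (1 : K[X]).degree < (P ^ (3 * m) * (h + (P * s) ^ 3)).degree := by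
      rw [degree_one, degree_eq_natDegree hmm.ne_zero]
      exact_mod_cast hpos
    have hfm : f.Monic := hmm.add_of_right hlt
    have hfn : f.natDegree = 3 * m * P.natDegree + e := by
      rw [hf, natDegree_add_eq_right_of_degree_lt hlt, hnd]
    have hfd : derivative f = P ^ (3 * m) * g := by
      have : f = 1 + (h + (P * s) ^ 3) * (P ^ m) ^ 3 := by rw [hf]; ring
      rw [this, derivative_add, deriv_mul_cube, derivative_add, deriv_cube, derivative_one]
      ring
    rw [hA f hfm hfn hfd hPd]
    push_cast
    rw [JJ_psi P g hirr f hPd, mul_assoc, ← psi_mul]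
    congr 1
    have hfe : emb (pp P g) f = (w * (u * w⁻¹ + emb (pp P g) s)) ^ 3 := by
      have e1 : f = (1 + P ^ (3 * m) * h) + (P ^ (m + 1) * s) ^ 3 := by rw [hf]; ring
      have e2 : w * (u * w⁻¹ + emb (pp P g) s) = u + w * emb (pp P g) s := by
        linear_combination u * hunit
      rw [e2, cube_add, hu, e1, map_add, map_pow, map_mul, hw]
    rw [hfe, psi_cube]
  rw [Finset.sum_congr rfl key, ← Finset.mul_sum, abs_mul]
  apply mul_le_of_le_one_left (abs_nonneg _)
  rw [abs_mul]
  have : |(ε : ℝ)| = 1 := by rcases hε with h | h <;> rw [h] <;> simp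
  rw [this, one_mul]
  exact psi_abs _ _ _

end Char


section Num

lemma ev_poly (Q : ℝ) (hQ : 2 ≤ Q) (Cst : ℝ) (hC : 0 < Cst) :
    ∃ e0 : ℕ, ∀ e : ℕ, e0 ≤ e → Cst * (1 + 4 * (e:ℝ)) ^ 2 ≤ Q ^ (e / 20) := by
  have h1 := tendsto_pow_const_div_const_pow_of_one_lt 2 (show (1:ℝ) < Q by linarith)
  have h2 := (h1.eventually (gt_mem_nhds (show (0:ℝ) < 1 / (Cst * 157 ^ 2) by positivity)))
  obtain ⟨u0, hu0⟩ := eventually_atTop.1 h2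
  refine ⟨20 * (u0 + 1), ?_⟩
  intro e he
  have h3 := hu0 (e / 20) (by omega)
  set u := e / 20 with hu
  have hu1 : 1 ≤ u := by omega
  have he' : 1 + 4 * (e:ℝ) ≤ 157 * u := by
    have : 1 + 4 * e ≤ 157 * u := by omega
    exact_mod_cast this
  have hQu : 0 < Q ^ u := by positivity
  rw [div_lt_div_iff₀ hQu (by positivity)] at h3
  calc Cst * (1 + 4 * (e:ℝ)) ^ 2 ≤ Cst * (157 * u) ^ 2 := by gcongr
    _ = (u:ℝ)^2 * (Cst * 157 ^ 2) := by ring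
    _ ≤ _ := by linarith

/-- purely numerical final step -/
lemma num_core {N a b c S M R ρ' B D Av : ℝ} {n : ℕ} (hN : 0 < N) (ha : 0 < a) (hb : 0 < b) (hbc : b = c * a)
    (hS : 0 ≤ S) (hD : 0 < D) (hA : 0 ≤ Av) (hc : c ≤ 4 * Av * N) (hM0 : 0 ≤ M)
    (hbu : (N * (a * S)) ^ (2 * (n + 1)) ≤ (N * b) ^ (2 * n) * (N ^ 2 * a + N * b) * M)
    (hM : M ≤ R * a ^ (n + 1) * ρ' + a ^ (2 * (n + 1)) * B)
    (h1 : (1 + 4 * Av) * (R * (a * ρ')) ≤ D ^ (2 * (n + 1)) / 2 * (b ^ 2 * a ^ (n + 1)))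
    (h2 : (1 + 4 * Av) * (a * B) ≤ D ^ (2 * (n + 1)) / 2 * b ^ 2) : S ≤ D * b := by
  have e1 : N ^ 2 * a + N * b ≤ N ^ 2 * a * (1 + 4 * Av) := by
    have : N * b ≤ N * (4 * Av * N * a) := by
      rw [hbc]; gcongr
    nlinarith
  have e2 : (1 + 4 * Av) * a * M ≤ D ^ (2 * (n + 1)) * b ^ 2 * a ^ (2 * (n + 1)) := by
    have t1 : (1 + 4 * Av) * a * M ≤ (1 + 4 * Av) * a * (R * a ^ (n + 1) * ρ' + a ^ (2 * (n + 1)) * B) := by gcongr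
    have t2 := mul_le_mul_of_nonneg_right h1 (show 0 ≤ a ^ (n + 1) by positivity)
    have t3 := mul_le_mul_of_nonneg_right h2 (show 0 ≤ a ^ (2 * (n + 1)) by positivity)
    have t4 : a ^ (2 * (n + 1)) = a ^ (n + 1) * a ^ (n + 1) := by rw [two_mul, pow_add]
    rw [t4] at t1 t3 ⊢
    clear hbu hM h1 h2 e1 t4
    generalize a ^ (n + 1) = w at t1 t2 t3 ⊢
    generalize D ^ (2 * (n + 1)) = y at t2 t3 ⊢
    linarith
  have e3 : (N * (a * S)) ^ (2 * (n + 1)) ≤ (N * (a * (D * b))) ^ (2 * (n + 1)) := by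
    calc _ ≤ _ := hbu
      _ ≤ (N * b) ^ (2 * n) * (N ^ 2 * a * (1 + 4 * Av)) * M := by gcongr
      _ = (N * b) ^ (2 * n) * N ^ 2 * ((1 + 4 * Av) * a * M) := by ring
      _ ≤ (N * b) ^ (2 * n) * N ^ 2 * (D ^ (2 * (n + 1)) * b ^ 2 * a ^ (2 * (n + 1))) := by gcongr
      _ = _ := by ring
  have e4 := (pow_le_pow_iff_left₀ (by positivity) (by positivity) (by omega)).1 e3
  have e5 := le_of_mul_le_mul_left e4 hN
  exact le_of_mul_le_mul_left e5 ha

end Num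

section BM
variable {K : Type} [Field K] [Fintype K]
variable {ι : Type} [Fintype ι] (p : ι → K[X]) [hp : ∀ i, Fact (Irreducible (p i))] (ex : ι → ℕ)

lemma burg_mom [CharP K 3] (hm : ∀ i, (p i).Monic) (hinj : Function.Injective p) {A κ L : ℕ} (hL : A + κ = L)
    (hAL : A + L ≤ rho p) (XX : Finset K[X])
    (hX : ∀ x ∈ XX, x.Monic ∧ Irreducible x ∧ (∀ i, p i ≠ x) ∧ x.natDegree = A) (hne : XX.Nonempty) (V : EE p) (n : ℕ)
    (he : ∀ i, κ ≤ (p i).natDegree → ex i = 1) (lg sm : ℕ)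
    (hlg : (Finset.univ.filter (fun i => κ ≤ (p i).natDegree)).card = lg)
    (hsm : ∑ i ∈ Finset.univ.filter (fun i => ¬ κ ≤ (p i).natDegree), (p i).natDegree = sm) :
    ∃ M : ℝ, 0 ≤ M ∧ 
    ((XX.card : ℝ) * ((Fintype.card K : ℝ) ^ κ * |∑ s ∈ PL K L, psi p ex (V + emb p s)|)) ^ (2 * (n + 1)) ≤
      ((XX.card : ℝ) * (Fintype.card K : ℝ) ^ L) ^ (2 * n) *
      ((XX.card : ℝ) ^ 2 * (Fintype.card K : ℝ) ^ κ + XX.card * (Fintype.card K : ℝ) ^ L) * M ∧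
    M ≤ ((n + 1 : ℕ) : ℝ) ^ (2 * (n + 1)) * ((Fintype.card K : ℝ) ^ κ) ^ (n + 1) * (Fintype.card K : ℝ) ^ (rho p) +
      ((Fintype.card K : ℝ) ^ κ) ^ (2 * (n + 1)) *
      √((3 * (8 * (2 * (n + 1) : ℕ) + 12) ^ 2 : ℝ) ^ lg * (Fintype.card K : ℝ) ^ (rho p + sm)) := by
  refine ⟨∑ v : EE p, WW p ex κ v ^ (2 * (n + 1)), ?_, burgess p ex hm hinj hL hAL XX hX hne V n, ?_⟩
  · apply Finset.sum_nonneg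
    intro v _
    rw [pow_mul]; positivity
  · subst hlg hsm
    exact moment p ex (n + 1) κ he

end BM

section GB
variable {K : Type} [Field K] [Fintype K]
open UniqueFactorizationMonoid

set_option maxHeartbeats 400000 in
lemma good_bound [CharP K 3] (P : K[X]) (hP : P.Monic) (hirr : Irreducible P) (K0 : ℕ) (hK0 : 36 ≤ K0) (δ : ℝ) (hδ : 0 < δ) :
    ∃ e0 : ℕ, ∀ e, e0 ≤ e → ∀ m h, h ∈ Mo K e → Good e (e / K0) (e / 3 - e / K0) h → P ∣ P ^ (3 * m) * h →
      |∑ s ∈ PL K (e / 3 - P.natDegree), (pmu (1 + P ^ (3 * m) * (h + (P * s) ^ 3)) : ℝ)| ≤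
        δ * (Fintype.card K : ℝ) ^ (e / 3 - P.natDegree) := by
  set dP := P.natDegree with hdP
  set Q : ℝ := (Fintype.card K : ℝ) with hQ
  have hq3 : 2 < Fintype.card K := by
    have h1 : 1 < Fintype.card K := Fintype.one_lt_card
    obtain ⟨m, hm⟩ := card_odd (K := K)
    omega
  have hQ2 : 2 ≤ Q := by rw [hQ]; exact_mod_cast hq3.le
  have hQ1 : 1 ≤ Q := by linarith
  obtain ⟨n, rfl⟩ : ∃ n, K0 = n + 1 := ⟨K0 - 1, by omega⟩
  set K0 := n + 1 with hK0d
  set c0 := 4 * dP + K0 + 8 with hc0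
  set C2 : ℝ := 3 * (8 * (2 * K0 : ℕ) + 12) ^ 2 with hC2
  have hC2p : 1 ≤ C2 := by
    rw [hC2]
    have : (0:ℝ) ≤ 8 * (2 * K0 : ℕ) := by positivity
    nlinarith
  set Dd : ℝ := δ ^ (2 * K0) / 2 with hDd
  have hDdp : 0 < Dd := by positivity
  obtain ⟨e1, he1⟩ := ev_poly Q hQ2 (((K0:ℝ) ^ (2 * K0)) * Q ^ c0 / Dd) (by positivity)
  obtain ⟨e2, he2⟩ := ev_poly Q hQ2 (C2 ^ (2 * K0) * Q ^ c0 / Dd ^ 2) (by positivity)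
  obtain ⟨e3, he3⟩ := ev_poly Q hQ2 1 (by positivity)
  refine ⟨e1 + e2 + e3 + 36 * K0 + 100 * dP + 1000, ?_⟩
  intro e he m h hh hG hd
  set κ := e / K0 with hκ
  have hz1 : K0 * κ ≤ e := Nat.mul_div_le e K0
  have hz2 : e < K0 * κ + K0 := by
    have := Nat.lt_mul_div_succ e (show 0 < K0 by omega)
    rw [← hκ] at this; linarith
  have h36 : 36 * κ ≤ e := (Nat.mul_le_mul_right κ hK0).trans hz1
  have hκ1 : 1 ≤ κ := by
    rw [hκ, Nat.one_le_div_iff (by omega)]; omega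
  set L := e / 3 - dP with hL
  obtain ⟨A, hA⟩ : ∃ A, A + κ = L := ⟨L - κ, by omega⟩
  obtain ⟨g0, gd, gρ, gex, gsum, gsm⟩ := good_struct hh hG
  have hcs := char_sum P hP hirr m e L h hh g0 hd (by omega)
  clear hG
  generalize derivative h = g at *
  obtain ⟨V, hV⟩ := hcs
  refine hV.trans ?_
  have hρ : rho (pp P g) = ∑ π ∈ (normalizedFactors g).toFinset.erase P, π.natDegree := by
    exact Finset.sum_coe_sort ((normalizedFactors g).toFinset.erase P) (fun π => π.natDegree)
  have hρ1 : rho (pp P g) ≤ e := by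
    rw [hρ]
    exact (Finset.sum_le_sum_of_subset (Finset.erase_subset _ _)).trans gsum
  have hρ2 : ∑ π ∈ (normalizedFactors g).toFinset, π.natDegree ≤ rho (pp P g) + dP := by
    rw [hρ]
    by_cases hPm : P ∈ (normalizedFactors g).toFinset
    · rw [← Finset.sum_erase_add _ _ hPm]
    · rw [Finset.erase_eq_of_notMem hPm]; omega
  have hAL : A + L ≤ rho (pp P g) := by omega
  have hm : ∀ i, ((pp P g) i).Monic := fun i => (pp_MI P g i).1
  have hinj : Function.Injective (pp P g) := Subtype.val_injective
  have hexx : ∀ i, κ ≤ ((pp P g) i).natDegree → (pex P g) i = 1 := fun i hi =>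
    gex i.1 (Finset.mem_of_mem_erase i.2) hi
  set lg := (Finset.univ.filter (fun i => κ ≤ ((pp P g) i).natDegree)).card with hlg
  set sm := ∑ i ∈ Finset.univ.filter (fun i => ¬ κ ≤ ((pp P g) i).natDegree), ((pp P g) i).natDegree with hsm
  have hsm1 : 6 * sm ≤ e := by
    refine le_trans (Nat.mul_le_mul_left 6 ?_) gsm
    rw [hsm, Finset.sum_filter]
    have : ∑ i : Idx P g, (if ¬ κ ≤ ((pp P g) i).natDegree then ((pp P g) i).natDegree else 0) =
        ∑ π ∈ (normalizedFactors g).toFinset.erase P, (if ¬ κ ≤ π.natDegree then π.natDegree else 0) := by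
      exact Finset.sum_coe_sort ((normalizedFactors g).toFinset.erase P) (fun π => if ¬ κ ≤ π.natDegree then π.natDegree else 0)
    rw [this, Finset.sum_filter]
    exact Finset.sum_le_sum_of_subset (Finset.erase_subset _ _)
  have hlg1 : lg * κ ≤ e := by
    refine le_trans ?_ hρ1
    rw [rho, hlg, ← smul_eq_mul]
    refine (Finset.card_nsmul_le_sum _ (fun i => ((pp P g) i).natDegree) κ (fun i hi => (Finset.mem_filter.1 hi).2)).trans ?_
    exact Finset.sum_le_sum_of_subset (Finset.filter_subset _ _)
  have hlg2 : lg ≤ 2 * K0 := by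
    by_contra hc
    have h1 : (2 * K0 + 1) * κ ≤ lg * κ := Nat.mul_le_mul_right _ (by omega)
    have h2 : K0 ≤ K0 * κ := Nat.le_mul_of_pos_right _ hκ1
    have h3 : (2 * K0 + 1) * κ = 2 * (K0 * κ) + κ := by ring
    omega
  have hcι : Fintype.card (Idx P g) ≤ e := by
    refine le_trans ?_ hρ1
    rw [rho, ← Finset.card_univ, Finset.card_eq_sum_ones]
    exact Finset.sum_le_sum (fun i _ => (pp_MI P g i).2.natDegree_pos)
  set XX := (Pr K A).filter (fun x => ∀ i, (pp P g) i ≠ x) with hXX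
  have hX : ∀ x ∈ XX, x.Monic ∧ Irreducible x ∧ (∀ i, (pp P g) i ≠ x) ∧ x.natDegree = A := by
    intro x hx
    rw [hXX, Finset.mem_filter, mem_Pr] at hx
    exact ⟨hx.1.1.1, hx.1.1.2, hx.2, hx.1.2⟩
  have hAe : e / 20 ≤ A := by omega
  have hAe2 : A ≤ e := by omega
  have hXc : (Pr K A).card ≤ XX.card + e := by
    have h1 : Pr K A ⊆ XX ∪ Finset.univ.image (pp P g) := by
      intro x hx
      rw [Finset.mem_union, hXX, Finset.mem_filter]
      by_cases h2 : ∀ i, (pp P g) i ≠ x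
      · exact Or.inl ⟨hx, h2⟩
      · push Not at h2
        obtain ⟨i, hi⟩ := h2
        exact Or.inr (Finset.mem_image.2 ⟨i, Finset.mem_univ _, hi⟩)
    refine (Finset.card_le_card h1).trans ((Finset.card_union_le _ _).trans ?_)
    have := Finset.card_image_le (s := Finset.univ) (f := (pp P g))
    rw [Finset.card_univ] at this
    omega
  have hPl := Pr_lower (K := K) A (by omega)
  have hXN : Q ^ A ≤ 4 * A * (XX.card : ℝ) := by
    have h1 : Q ^ A ≤ 2 * (A * ((XX.card : ℝ) + e)) := by
      have : Fintype.card K ^ A ≤ 2 * (A * (XX.card + e)) := hPl.trans (by gcongr)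
      rw [hQ]
      exact_mod_cast this
    have h2 := he3 e (by omega)
    have h3 : Q ^ (e / 20) ≤ Q ^ A := pow_le_pow_right₀ hQ1 hAe
    have h4 : (A:ℝ) ≤ e := by exact_mod_cast hAe2
    have h5 : (0:ℝ) ≤ A := by positivity
    nlinarith
  have hQA : 0 < Q ^ A := by positivity
  have hXpos : 0 < XX.card := by
    rcases Nat.eq_zero_or_pos XX.card with h0 | h0
    · rw [h0] at hXN; simp at hXN; linarith
    · exact h0
  obtain ⟨M, hM0, hbu, hmo⟩ := burg_mom (pp P g) (pex P g) hm hinj hA hAL XX hX (Finset.card_pos.1 hXpos) V n hexx lg sm rfl rfl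
  have hAef : 1 + 4 * (A : ℝ) ≤ 1 + 4 * e := by
    have : (A:ℝ) ≤ e := by exact_mod_cast hAe2
    linarith
  have hQL : 0 < Q ^ L := by positivity
  have hS0 := abs_nonneg (∑ s ∈ PL K L, psi (pp P g) (pex P g) (V + emb (pp P g) s))
  generalize |∑ s ∈ PL K L, psi (pp P g) (pex P g) (V + emb (pp P g) s)| = S at hbu hS0 ⊢
  have hXp : (0:ℝ) < XX.card := by exact_mod_cast hXpos
  have hQκ : 0 < Q ^ κ := by positivity
  have hbc : Q ^ L = Q ^ A * Q ^ κ := by rw [← pow_add, hA]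
  have hA0 : (0:ℝ) ≤ A := by positivity
  refine num_core (N := (XX.card : ℝ)) (a := Q ^ κ) (b := Q ^ L) (c := Q ^ A) (S := S) (M := M)
    (R := ((n + 1 : ℕ) : ℝ) ^ (2 * (n + 1))) (ρ' := Q ^ rho (pp P g)) (B := √(C2 ^ lg * Q ^ (rho (pp P g) + sm)))
    (D := δ) (Av := A) (n := n) hXp hQκ hQL hbc hS0 hδ hA0 hXN hM0 hbu hmo ?_ ?_
  · have t1 := he1 e (by omega)
    rw [div_mul_eq_mul_div, div_le_iff₀ hDdp] at t1
    have t2 : Q ^ (κ + rho (pp P g) + e / 20) ≤ Q ^ (2 * L + K0 * κ + c0) := pow_le_pow_right₀ hQ1 (by omega)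
    have t3 : (1 + 4 * (A:ℝ)) ≤ (1 + 4 * (e:ℝ)) ^ 2 := by
      have : (0:ℝ) ≤ e := by positivity
      nlinarith
    have hp1 : 0 < Q ^ (e / 20) := by positivity
    have hp2 : 0 < Q ^ c0 := by positivity
    apply le_of_mul_le_mul_right _ hp2
    apply le_of_mul_le_mul_right _ hp1
    calc (1 + 4 * (A:ℝ)) * (((n + 1 : ℕ) : ℝ) ^ (2 * (n + 1)) * (Q ^ κ * Q ^ rho (pp P g))) * Q ^ c0 * Q ^ (e / 20)
        = ((K0:ℝ) ^ (2 * K0) * Q ^ c0 * (1 + 4 * (A:ℝ))) * Q ^ (κ + rho (pp P g) + e / 20) := by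
          rw [pow_add, pow_add]; ring
      _ ≤ ((K0:ℝ) ^ (2 * K0) * Q ^ c0 * (1 + 4 * (e:ℝ)) ^ 2) * Q ^ (2 * L + K0 * κ + c0) := by gcongr
      _ ≤ (Q ^ (e / 20) * Dd) * Q ^ (2 * L + K0 * κ + c0) := by gcongr
      _ = _ := by rw [pow_add, pow_add, pow_mul' Q 2 L, pow_mul' Q K0 κ]; ring
  · have t1 := he2 e (by omega)
    rw [div_mul_eq_mul_div, div_le_iff₀ (by positivity)] at t1
    have t2 : Q ^ (2 * κ + (rho (pp P g) + sm) + e / 20) ≤ Q ^ (4 * L + c0) := pow_le_pow_right₀ hQ1 (by omega)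
    have hp1 : 0 < Q ^ (e / 20) := by positivity
    have hp2 : 0 < Q ^ c0 := by positivity
    rw [← pow_le_pow_iff_left₀ (by positivity) (by positivity) (two_ne_zero)]
    rw [mul_pow, mul_pow, Real.sq_sqrt (by positivity)]
    apply le_of_mul_le_mul_right _ hp2
    apply le_of_mul_le_mul_right _ hp1
    calc (1 + 4 * (A:ℝ)) ^ 2 * ((Q ^ κ) ^ 2 * (C2 ^ lg * Q ^ (rho (pp P g) + sm))) * Q ^ c0 * Q ^ (e / 20)
        = (C2 ^ lg * Q ^ c0 * (1 + 4 * (A:ℝ)) ^ 2) * Q ^ (2 * κ + (rho (pp P g) + sm) + e / 20) := by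
          rw [pow_add Q (2 * κ + (rho (pp P g) + sm)), pow_add Q (2 * κ), pow_mul' Q 2 κ]; ring
      _ ≤ (C2 ^ (2 * K0) * Q ^ c0 * (1 + 4 * (e:ℝ)) ^ 2) * Q ^ (4 * L + c0) := by gcongr
      _ ≤ (Q ^ (e / 20) * Dd ^ 2) * Q ^ (4 * L + c0) := by gcongr
      _ = _ := by rw [pow_add, pow_mul' Q 4 L]; ring

end GB


section Final
variable {K : Type} [Field K] [Fintype K]

lemma pmu_abs (f : K[X]) : |(pmu f : ℝ)| ≤ 1 := by
  unfold pmu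
  split_ifs with h
  · push_cast; simp
  · simp

lemma ev_exp (Q : ℝ) (hQ : 2 ≤ Q) (K0 : ℕ) (hK : 36 ≤ K0) (η : ℝ) (hη : 0 < η) :
    ∃ e0 : ℕ, ∀ e : ℕ, e0 ≤ e → ((e:ℝ) + 2) / Q ^ (e / K0) ≤ η := by
  have h1 := tendsto_pow_const_div_const_pow_of_one_lt 1 (show (1:ℝ) < Q by linarith)
  have h2 := (h1.eventually (gt_mem_nhds (show (0:ℝ) < η / (3 * K0) by positivity)))
  obtain ⟨u0, hu0⟩ := eventually_atTop.1 h2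
  refine ⟨K0 * (u0 + 1), ?_⟩
  intro e he
  have hu2 : u0 + 1 ≤ e / K0 := (Nat.le_div_iff_mul_le (by omega)).2 (by linarith)
  have hz2 : e < K0 * (e / K0) + K0 := by
    have := Nat.lt_mul_div_succ e (show 0 < K0 by omega)
    linarith
  have h3 := hu0 (e / K0) (by omega)
  set u := e / K0 with hu
  have he' : (e:ℝ) + 2 ≤ 3 * K0 * u := by
    have h4 : K0 ≤ K0 * u := Nat.le_mul_of_pos_right _ (by omega)
    have : e + 2 ≤ 3 * (K0 * u) := by omega
    have h5 : ((e + 2 : ℕ) : ℝ) ≤ ((3 * (K0 * u) : ℕ) : ℝ) := by exact_mod_cast this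
    push_cast at h5
    linarith
  have hQu : 0 < Q ^ u := by positivity
  rw [pow_one, div_lt_div_iff₀ hQu (by positivity)] at h3
  rw [div_le_iff₀ hQu]
  linarith

lemma good_transl [CharP K 3] (e κ t : ℕ) (h w : K[X]) : Good e κ t (h + w ^ 3) ↔ Good e κ t h := by
  have : derivative (h + w ^ 3) = derivative h := by rw [derivative_add, deriv_cube, add_zero]
  unfold Good smallSum
  rw [this]

lemma reindex (P : K[X]) (hP : P.Monic) (i j : ℕ) (F : K[X] → ℝ) :
    ∑ g ∈ Mo K j, F (P ^ i * g) = ∑ h ∈ (Mo K (j + i * P.natDegree)).filter (fun h => P ^ i ∣ h), F h := by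
  apply Finset.sum_bij (fun g _ => P ^ i * g)
  · intro g hg
    rw [mem_Mo] at hg
    rw [Finset.mem_filter, mem_Mo]
    refine ⟨⟨(hP.pow _).mul hg.1, ?_⟩, dvd_mul_right _ _⟩
    rw [(hP.pow _).natDegree_mul hg.1, hP.natDegree_pow, hg.2, add_comm]
  · intro a _ b _ hab
    exact mul_left_cancel₀ (hP.pow i).ne_zero hab
  · intro h hh
    rw [Finset.mem_filter, mem_Mo] at hh
    obtain ⟨⟨h1, h2⟩, g, rfl⟩ := hh
    have hg : g.Monic := (hP.pow i).of_mul_monic_left h1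
    refine ⟨g, ?_, rfl⟩
    rw [mem_Mo]
    rw [(hP.pow _).natDegree_mul hg, hP.natDegree_pow] at h2
    exact ⟨hg, by omega⟩
  · intro g _; rfl

lemma level [CharP K 3] (P : K[X]) (hP : P.Monic) (hirr : Irreducible P) (ε : ℝ) (hε : 0 < ε) :
    ∃ j0 : ℕ, ∀ j, j0 ≤ j → ∀ n, 1 ≤ n →
      |∑ g ∈ Mo K j, (pmu (1 + P ^ n * g) : ℝ)| ≤ ε * (Fintype.card K : ℝ) ^ j := by
  have hq3 : 2 < Fintype.card K := by
    have h1 : 1 < Fintype.card K := Fintype.one_lt_card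
    obtain ⟨m, hm⟩ := card_odd (K := K)
    omega
  have hQ2 : (2:ℝ) ≤ (Fintype.card K : ℝ) := by exact_mod_cast hq3.le
  generalize hQ : (Fintype.card K : ℝ) = Q at *
  have hQ1 : 1 ≤ Q := by linarith
  set dP := P.natDegree with hdP
  set η := ε / Q ^ (2 * dP) with hη
  have hη0 : 0 < η := by positivity
  obtain ⟨k1, hk1⟩ := exists_nat_gt (18 / η)
  set K0 := k1 + 36 with hK0
  have hK0e : 6 / (K0:ℝ) ≤ η / 3 := by
    rw [div_le_div_iff₀ (by positivity) (by norm_num)]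
    rw [div_lt_iff₀ hη0] at hk1
    have : (k1:ℝ) ≤ K0 := by rw [hK0]; push_cast; linarith
    nlinarith
  obtain ⟨e1, he1⟩ := good_bound P hP hirr K0 (by omega) (η / 3) (by positivity)
  obtain ⟨e2, he2⟩ := ev_exp Q hQ2 K0 (by omega) (η / 3) (by positivity)
  refine ⟨e1 + e2 + 6 * dP + 36, ?_⟩
  intro j hj n hn
  obtain ⟨m, i, hi, hnm⟩ : ∃ m i, i < 3 ∧ n = 3 * m + i := ⟨n / 3, n % 3, by omega, by omega⟩
  set e := j + i * dP with he
  have hje : j ≤ e := by omega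
  set F : K[X] → ℝ := fun h => (pmu (1 + P ^ (3 * m) * h) : ℝ) with hF
  have hsum : ∑ g ∈ Mo K j, (pmu (1 + P ^ n * g) : ℝ) = ∑ h ∈ (Mo K e).filter (fun h => P ^ i ∣ h), F h := by
    rw [← reindex P hP i j F]
    apply Finset.sum_congr rfl
    intro g _
    rw [hF, hnm, pow_add, mul_assoc]
  set κ := e / K0 with hκ
  set t := e / 3 - e / K0 with ht
  set L := e / 3 - dP with hL
  have h36 : 36 * κ ≤ e := (Nat.mul_le_mul_right κ (show 36 ≤ K0 by omega)).trans (Nat.mul_div_le e K0)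
  have hbad := bad_total (K := K) e κ t (by omega) (by omega)
  rw [hQ] at hbad
  rw [hsum, ← Finset.sum_filter_add_sum_filter_not _ (fun h => Good e κ t h), Finset.filter_filter]
  set G := (Mo K e).filter (fun h => P ^ i ∣ h ∧ Good e κ t h) with hG
  have hcG : (G.card : ℝ) ≤ Q ^ e := by
    have := Finset.card_filter_le (Mo K e) (fun h => P ^ i ∣ h ∧ Good e κ t h)
    rw [card_Mo] at this
    rw [← hQ]
    exact_mod_cast this
  have hQL : 0 < Q ^ L := by positivity
  have hgood : |∑ h ∈ G, F h| ≤ η / 3 * Q ^ e := by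
    have h1 : Q ^ L * ∑ h ∈ G, F h = ∑ h ∈ G, ∑ s ∈ PL K L, F (h + (P * s) ^ 3) := by
      rw [Finset.sum_comm]
      have : ∀ s ∈ PL K L, ∑ h ∈ G, F (h + (P * s) ^ 3) = ∑ h ∈ G, F h := by
        intro s hs
        apply sum_transl
        · have h1 : P * s ∈ PL K (dP + L) := mul_mem_PL le_rfl hs
          have h2 := X_pow_cube_mem (e := e) (k := dP + L) (i := 0) (by omega) h1
          simpa using h2
        · intro h
          rw [good_transl]
          have hd : P ^ i ∣ (P * s) ^ 3 := by
            rw [mul_pow]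
            exact (pow_dvd_pow P (by omega)).mul_right _
          rw [dvd_add_left hd]
      rw [Finset.sum_congr rfl this, Finset.sum_const, card_PL, nsmul_eq_mul, ← hQ]
      push_cast; rfl
    have h2 : |Q ^ L * ∑ h ∈ G, F h| ≤ G.card * (η / 3 * Q ^ L) := by
      rw [h1, ← nsmul_eq_mul]
      refine (Finset.abs_sum_le_sum_abs _ _).trans ?_
      apply Finset.sum_le_card_nsmul
      intro h hh
      rw [hG, Finset.mem_filter] at hh
      have := he1 e (by omega) m h hh.1 hh.2.2 ?_
      · rw [hQ] at this; exact this
      · rcases Nat.eq_zero_or_pos m with hm0 | hm0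
        · exact dvd_mul_of_dvd_right ((dvd_pow_self P (by omega)).trans hh.2.1) _
        · exact dvd_mul_of_dvd_left (dvd_pow_self P (by omega)) _
    rw [abs_mul, abs_of_pos hQL] at h2
    apply le_of_mul_le_mul_left _ hQL
    refine h2.trans ?_
    calc (G.card : ℝ) * (η / 3 * Q ^ L) ≤ Q ^ e * (η / 3 * Q ^ L) := by gcongr
      _ = _ := by ring
  have hbadF : |∑ h ∈ ((Mo K e).filter (fun h => P ^ i ∣ h)).filter (fun h => ¬ Good e κ t h), F h| ≤
      (6 * κ / e + (e + 2) / Q ^ κ) * Q ^ e := by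
    refine le_trans ?_ hbad
    refine (Finset.abs_sum_le_sum_abs _ _).trans ?_
    refine (Finset.sum_le_card_nsmul _ _ 1 (fun h _ => pmu_abs _)).trans ?_
    rw [nsmul_eq_mul, mul_one]
    have := Finset.card_le_card (Finset.filter_subset_filter (fun h => ¬ Good e κ t h)
      (Finset.filter_subset (fun h => P ^ i ∣ h) (Mo K e)))
    exact_mod_cast this
  have hκe : 6 * (κ:ℝ) / e ≤ η / 3 := by
    refine le_trans ?_ hK0e
    have hepos : (0:ℝ) < e := by exact_mod_cast (show 0 < e by omega)
    rw [div_le_div_iff₀ hepos (by positivity)]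
    have : κ * K0 ≤ e := Nat.div_mul_le_self e K0
    have : (κ:ℝ) * K0 ≤ e := by exact_mod_cast this
    linarith
  have h3 := he2 e (by omega)
  have hQe : 0 < Q ^ e := by positivity
  calc |∑ h ∈ G, F h + ∑ h ∈ ((Mo K e).filter (fun h => P ^ i ∣ h)).filter (fun h => ¬ Good e κ t h), F h|
      ≤ η / 3 * Q ^ e + (6 * κ / e + (e + 2) / Q ^ κ) * Q ^ e := (abs_add_le _ _).trans (add_le_add hgood hbadF)
    _ ≤ η / 3 * Q ^ e + (η / 3 + η / 3) * Q ^ e := by gcongr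
    _ = η * Q ^ e := by ring
    _ ≤ η * (Q ^ j * Q ^ (2 * dP)) := by
      apply mul_le_mul_of_nonneg_left _ hη0.le
      rw [← pow_add]
      apply pow_le_pow_right₀ hQ1
      have : i * dP ≤ 2 * dP := Nat.mul_le_mul_right _ (by omega)
      omega
    _ = ε * Q ^ j := by rw [hη]; field_simp

lemma geomQ_le (Q : ℝ) (hQ : 2 ≤ Q) (n : ℕ) : ∑ j ∈ Finset.range n, Q ^ j ≤ Q ^ n := by
  induction n with
  | zero => simp
  | succ n ih =>
    rw [Finset.sum_range_succ, pow_succ]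
    have : 0 < Q ^ n := by positivity
    nlinarith

lemma set_eq (P : K[X]) (hP : P.Monic) (hirr : Irreducible P) (n d J : ℕ) (hn : 1 ≤ n) (hJ : d = J + n * P.natDegree) :
    {f : K[X] | f.Monic ∧ pnorm f ≤ (Fintype.card K : ℝ) ^ d ∧ P ^ n ∣ (f - 1)} =
      ((insert 1 ((Finset.range (J + 1)).biUnion (fun j => (Mo K j).image (fun g => 1 + P ^ n * g))) : Finset K[X]) : Set K[X]) := by
  have hQ1 : (1:ℝ) < (Fintype.card K : ℝ) := by exact_mod_cast Fintype.one_lt_card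
  have hpos := hirr.natDegree_pos
  have hnorm : ∀ f : K[X], f.Monic → (pnorm f ≤ (Fintype.card K : ℝ) ^ d ↔ f.natDegree ≤ d) := by
    intro f hf
    rw [pnorm, if_neg hf.ne_zero]
    exact pow_le_pow_iff_right₀ hQ1
  have hPn : 1 ≤ n * P.natDegree := Nat.mul_pos (by omega) hpos
  ext f
  simp only [Set.mem_ofPred_eq, Finset.coe_insert, Set.mem_insert_iff, Finset.mem_coe, Finset.mem_biUnion,
    Finset.mem_range, Finset.mem_image]
  constructor
  · rintro ⟨hf, hfd, g, hg⟩
    rw [hnorm f hf] at hfd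
    by_cases h1 : f = 1
    · exact Or.inl h1
    right
    have hfpos : 0 < f.natDegree := by
      rcases Nat.eq_zero_or_pos f.natDegree with h | h
      · exact absurd (hf.natDegree_eq_zero.1 h) h1
      · exact h
    have hlt : (1 : K[X]).degree < f.degree := by
      rw [degree_one, degree_eq_natDegree hf.ne_zero]; exact_mod_cast hfpos
    have hm : (f - 1).Monic := hf.sub_of_left hlt
    have hd : (f - 1).natDegree = f.natDegree := natDegree_sub_eq_left_of_natDegree_lt (by rw [natDegree_one]; exact hfpos)
    rw [hg] at hm hd
    have hgm : g.Monic := (hP.pow n).of_mul_monic_left hm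
    rw [(hP.pow _).natDegree_mul hgm, hP.natDegree_pow] at hd
    refine ⟨g.natDegree, by omega, g, mem_Mo.2 ⟨hgm, rfl⟩, ?_⟩
    rw [← hg]; ring
  · rintro (rfl | ⟨j, hj, g, hg, rfl⟩)
    · refine ⟨monic_one, ?_, by simp⟩
      rw [hnorm _ monic_one, natDegree_one]; omega
    · rw [mem_Mo] at hg
      have hm : (P ^ n * g).Monic := (hP.pow n).mul hg.1
      have hd : (P ^ n * g).natDegree = n * P.natDegree + j := by
        rw [(hP.pow _).natDegree_mul hg.1, hP.natDegree_pow, hg.2]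
      have hlt : (1 : K[X]).degree < (P ^ n * g).degree := by
        rw [degree_one, degree_eq_natDegree hm.ne_zero, hd]; exact_mod_cast (by omega)
      have hfm : (1 + P ^ n * g).Monic := hm.add_of_right hlt
      refine ⟨hfm, ?_, by simp⟩
      rw [hnorm _ hfm, natDegree_add_eq_right_of_degree_lt hlt, hd]
      omega

lemma sum_bound (P : K[X]) (hP : P.Monic) (n J : ℕ) :
    |∑ f ∈ insert 1 ((Finset.range (J + 1)).biUnion (fun j => (Mo K j).image (fun g => 1 + P ^ n * g))), (pmu f : ℝ)| ≤
      1 + ∑ j ∈ Finset.range (J + 1), |∑ g ∈ Mo K j, (pmu (1 + P ^ n * g) : ℝ)| := by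
  have hinj : Function.Injective (fun g => 1 + P ^ n * g) := by
    intro a b hab
    exact mul_left_cancel₀ (hP.pow n).ne_zero (add_left_cancel hab)
  rw [Finset.sum_insert]
  · refine (abs_add_le _ _).trans (add_le_add (pmu_abs _) ?_)
    rw [Finset.sum_biUnion]
    · refine (Finset.abs_sum_le_sum_abs _ _).trans (le_of_eq ?_)
      apply Finset.sum_congr rfl
      intro j _
      rw [Finset.sum_image (fun a _ b _ h => hinj h)]
    · intro a _ b _ hab
      rw [Function.onFun, Finset.disjoint_left]
      intro f h1 h2
      obtain ⟨g1, hg1, rfl⟩ := Finset.mem_image.1 h1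
      obtain ⟨g2, hg2, h3⟩ := Finset.mem_image.1 h2
      have := hinj h3
      subst this
      exact hab ((mem_Mo.1 hg1).2.symm.trans (mem_Mo.1 hg2).2)
  · intro h
    simp only [Finset.mem_biUnion, Finset.mem_image] at h
    obtain ⟨j, _, g, hg, h1⟩ := h
    have h2 : P ^ n * g = 0 := by linear_combination h1
    exact (mul_ne_zero (hP.pow n).ne_zero (mem_Mo.1 hg).1.ne_zero) h2

end Final

theorem statement8 (q : ℕ) (hq : ∃ n : ℕ, 1 ≤ n ∧ q = 3 ^ n)
    (Fq : Type) [Field Fq] [Fintype Fq] (hcard : Fintype.card Fq = q)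
    (P : Polynomial Fq) (hP : P.Monic) (hirr : Irreducible P) :
    ∀ ε : ℝ, 0 < ε → ∃ N : ℝ, ∀ n : ℕ, 1 ≤ n → ∀ d : ℕ,
      N ≤ (q : ℝ) ^ d / (pnorm P) ^ n →
      |∑ᶠ f ∈ {f : Polynomial Fq | f.Monic ∧ pnorm f ≤ (q : ℝ) ^ d ∧ P ^ n ∣ (f - 1)},
          (pmu f : ℝ)|
        ≤ ε * ((q : ℝ) ^ d / (pnorm P) ^ n) := by
  intro ε hε
  subst hcard
  have h3 : Fact (Nat.Prime 3) := ⟨by norm_num⟩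
  obtain ⟨a, ha, hqa⟩ := hq
  have hchar : CharP Fq 3 := charP_of_card_eq_prime_pow hqa
  obtain ⟨j0, hj0⟩ := level P hP hirr (ε / 4) (by positivity)
  have hQ2 : (2:ℝ) ≤ (Fintype.card Fq : ℝ) := by
    exact_mod_cast (Fintype.one_lt_card (α := Fq))
  set Q : ℝ := (Fintype.card Fq : ℝ) with hQ
  refine ⟨max 1 ((1 + Q ^ j0) * 2 / ε), ?_⟩
  intro n hn d hN
  have hpn : pnorm P = Q ^ P.natDegree := by rw [pnorm, if_neg hP.ne_zero]
  rw [hpn, ← pow_mul] at hN ⊢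
  have hge : P.natDegree * n ≤ d := by
    have h1 := (le_max_left _ _).trans hN
    rw [le_div_iff₀ (by positivity), one_mul] at h1
    exact (pow_le_pow_iff_right₀ (by linarith)).1 h1
  obtain ⟨J, hJ⟩ : ∃ J, d = J + n * P.natDegree := ⟨d - n * P.natDegree, by rw [mul_comm n]; omega⟩
  have hdiv : Q ^ d / Q ^ (P.natDegree * n) = Q ^ J := by
    rw [hJ, mul_comm n, pow_add]; field_simp
  rw [hdiv] at hN ⊢
  rw [hQ, set_eq P hP hirr n d J hn hJ, finsum_mem_coe_finset, ← hQ]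
  refine (sum_bound P hP n J).trans ?_
  have hj : ∀ j ∈ Finset.range (J + 1), |∑ g ∈ Mo Fq j, (pmu (1 + P ^ n * g) : ℝ)| ≤
      (if j < j0 then Q ^ j else 0) + ε / 4 * Q ^ j := by
    intro j _
    by_cases h : j < j0
    · rw [if_pos h]
      have h1 : |∑ g ∈ Mo Fq j, (pmu (1 + P ^ n * g) : ℝ)| ≤ Q ^ j := by
        refine (Finset.abs_sum_le_sum_abs _ _).trans ?_
        refine (Finset.sum_le_card_nsmul _ _ 1 (fun h _ => pmu_abs _)).trans ?_
        rw [card_Mo, nsmul_eq_mul, mul_one, hQ]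
        push_cast; exact le_rfl
      have : 0 ≤ ε / 4 * Q ^ j := by positivity
      linarith
    · rw [if_neg h, zero_add]
      exact hj0 j (by omega) n hn
  have hs1 : ∑ j ∈ Finset.range (J + 1), (if j < j0 then Q ^ j else 0) ≤ Q ^ j0 := by
    rw [← Finset.sum_filter]
    refine (Finset.sum_le_sum_of_subset_of_nonneg (t := Finset.range j0) ?_ (fun _ _ _ => by positivity)).trans (geomQ_le Q hQ2 j0)
    intro j hj
    exact Finset.mem_range.2 (Finset.mem_filter.1 hj).2
  have hs2 : ∑ j ∈ Finset.range (J + 1), Q ^ j ≤ 2 * Q ^ J := by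
    rw [Finset.sum_range_succ]
    have := geomQ_le Q hQ2 J
    linarith
  have hs3 := Finset.sum_le_sum hj
  rw [Finset.sum_add_distrib, ← Finset.mul_sum] at hs3
  have h5 := (le_max_right _ _).trans hN
  rw [div_le_iff₀ hε] at h5
  have h6 : ε / 4 * ∑ j ∈ Finset.range (J + 1), Q ^ j ≤ ε / 4 * (2 * Q ^ J) := by gcongr
  linarith
end

section
/- Let q be an odd prime power, let f ∈ F_q[T], and let g ∈ F_q[T] have degree n ≥ 1 with leading coefficient a_n. Then the Jacobi symbol satisfies (f/g) = ψ(a_n)^{max{deg f, 0}} · ψ(Res(g, f)), where Res(g,f) denotes the resultant of g and f, and max{deg f, 0} = 0 when f = 0. -/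
open scoped Classical
open Polynomial Filter

/-- The quadratic character of `F_q`: `1` on nonzero squares, `-1` on nonsquares, `0` at `0`. -/
noncomputable def quadChar {Fq : Type} [Field Fq] (x : Fq) : ℤ :=
  if x = 0 then 0 else if ∃ y : Fq, y ^ 2 = x then 1 else -1

/-- The Legendre symbol `(f/P)` for an irreducible `P`: `1` if `f` is a nonzero square mod `P`,
`-1` if it is a nonzero nonsquare, `0` if `P ∣ f`. -/
noncomputable def legendreSymbolPoly {Fq : Type} [Field Fq] (f P : Polynomial Fq) : ℤ :=
  if P ∣ f then 0 else if ∃ z : Polynomial Fq, P ∣ (z ^ 2 - f) then 1 else -1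

/-- The Jacobi symbol `(f/g) = ∏ (f/P_i)^(e_i)`, the product over the factorization of `g`
into monic irreducibles (with multiplicity). -/
noncomputable def jacobiSymbolPoly {Fq : Type} [Field Fq] (f g : Polynomial Fq) : ℤ :=
  ((UniqueFactorizationMonoid.normalizedFactors g).map
    (fun P => legendreSymbolPoly f P)).prod

/-- The resultant `Res(g, f) = lc(g)^(deg f) · ∏_θ f(θ)`, the product over the roots of `g`
with multiplicity; realized as `lc(g)^(deg f)` times the norm of (multiplication by) `f` in
`F_q[T]/(g₁)`, `g₁` the monic normalization of `g`. -/
noncomputable def presultant {Fq : Type} [Field Fq] (g f : Polynomial Fq) : Fq :=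
  g.leadingCoeff ^ f.natDegree *
    Algebra.norm Fq (Ideal.Quotient.mk (Ideal.span {(normalize g : Polynomial Fq)}) f)

theorem det_of_exact {F V₁ V V₂ : Type} [Field F] [AddCommGroup V₁] [AddCommGroup V]
    [AddCommGroup V₂] [Module F V₁] [Module F V] [Module F V₂] [FiniteDimensional F V]
    (φ : V₁ →ₗ[F] V) (ψ : V →ₗ[F] V₂) (hφ : Function.Injective φ) (hψ : Function.Surjective ψ)
    (hex : LinearMap.range φ = LinearMap.ker ψ)
    (e₁ : V₁ →ₗ[F] V₁) (e : V →ₗ[F] V) (e₂ : V₂ →ₗ[F] V₂)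
    (h₁ : ∀ x, e (φ x) = φ (e₁ x)) (h₂ : ∀ x, ψ (e x) = e₂ (ψ x)) :
    LinearMap.det e = LinearMap.det e₁ * LinearMap.det e₂ := by
  have he : LinearMap.ker ψ ≤ (LinearMap.ker ψ).comap e := by
    intro x hx
    simp only [Submodule.mem_comap, LinearMap.mem_ker] at hx ⊢
    rw [h₂, hx, map_zero]
  rw [LinearMap.det_eq_det_mul_det (LinearMap.ker ψ) e he]
  let E₁ : V₁ ≃ₗ[F] LinearMap.ker ψ :=
    (LinearEquiv.ofInjective φ hφ).trans (LinearEquiv.ofEq _ _ hex)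
  have hE₁ : ∀ x, ((E₁ x : LinearMap.ker ψ) : V) = φ x := fun x => rfl
  let E₂ : (V ⧸ LinearMap.ker ψ) ≃ₗ[F] V₂ := ψ.quotKerEquivOfSurjective hψ
  have hE₂ : ∀ x : V, E₂ (Submodule.Quotient.mk x) = ψ x := fun x => rfl
  congr 1
  · rw [← LinearMap.det_conj e₁ E₁]
    congr 1
    ext x
    obtain ⟨y, rfl⟩ := E₁.surjective x
    simp [hE₁, h₁]
  · rw [← LinearMap.det_conj _ E₂]
    congr 1
    ext x
    obtain ⟨y, rfl⟩ := E₂.surjective x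
    obtain ⟨z, rfl⟩ := Submodule.Quotient.mk_surjective _ y
    have hsy : E₂.symm (ψ z) = Submodule.Quotient.mk z := by
      rw [← hE₂, LinearEquiv.symm_apply_apply]
    rw [hE₂, LinearMap.comp_apply, LinearMap.comp_apply, LinearEquiv.coe_coe, LinearEquiv.coe_coe,
      hsy, Submodule.mapQ_apply, hE₂, h₂]

noncomputable def nrm {Fq : Type} [Field Fq] (g f : Polynomial Fq) : Fq :=
  Algebra.norm Fq (Ideal.Quotient.mk (Ideal.span {g}) f)

theorem fd_quot {Fq : Type} [Field Fq] (g : Polynomial Fq) (hg : g ≠ 0) :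
    FiniteDimensional Fq (Polynomial Fq ⧸ Ideal.span {g}) :=
  (AdjoinRoot.powerBasis hg).finite

theorem nrm_mul {Fq : Type} [Field Fq] (a b f : Polynomial Fq) (ha : a ≠ 0) (hb : b ≠ 0) :
    nrm (a * b) f = nrm b f * nrm a f := by
  have := fd_quot (a * b) (mul_ne_zero ha hb)
  let φ : (Polynomial Fq ⧸ Ideal.span {b}) →ₗ[Fq] (Polynomial Fq ⧸ Ideal.span {a * b}) :=
    (Submodule.mapQ (Ideal.span {b}) (Ideal.span {a * b})
      (LinearMap.mulLeft (Polynomial Fq) a) (by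
        intro x hx
        simp only [Submodule.mem_comap, LinearMap.mulLeft_apply]
        rw [Ideal.mem_span_singleton] at hx ⊢
        exact mul_dvd_mul_left a hx)).restrictScalars Fq
  let ψ : (Polynomial Fq ⧸ Ideal.span {a * b}) →ₗ[Fq] (Polynomial Fq ⧸ Ideal.span {a}) :=
    (Submodule.mapQ (Ideal.span {a * b}) (Ideal.span {a}) LinearMap.id (by
        intro x hx
        simp only [Submodule.mem_comap, LinearMap.id_apply]
        rw [Ideal.mem_span_singleton] at hx ⊢
        exact (dvd_mul_right a b).trans hx)).restrictScalars Fq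
  have hφ : ∀ x : Polynomial Fq, φ (Ideal.Quotient.mk _ x) = Ideal.Quotient.mk _ (a * x) :=
    fun x => rfl
  have hψ : ∀ x : Polynomial Fq, ψ (Ideal.Quotient.mk _ x) = Ideal.Quotient.mk _ x :=
    fun x => rfl
  unfold nrm
  simp only [Algebra.norm_apply]
  refine det_of_exact φ ψ ?_ ?_ ?_ _ _ _ ?_ ?_
  · rw [injective_iff_map_eq_zero]
    intro x hx
    obtain ⟨x, rfl⟩ := Ideal.Quotient.mk_surjective x
    rw [hφ, Ideal.Quotient.eq_zero_iff_mem, Ideal.mem_span_singleton] at hx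
    rw [Ideal.Quotient.eq_zero_iff_mem, Ideal.mem_span_singleton]
    exact (mul_dvd_mul_iff_left ha).1 hx
  · intro x
    obtain ⟨x, rfl⟩ := Ideal.Quotient.mk_surjective x
    exact ⟨_, hψ x⟩
  · ext x
    obtain ⟨x, rfl⟩ := Ideal.Quotient.mk_surjective x
    rw [LinearMap.mem_ker, hψ, Ideal.Quotient.eq_zero_iff_mem, Ideal.mem_span_singleton,
      LinearMap.mem_range]
    constructor
    · rintro ⟨y, hy⟩
      obtain ⟨y, rfl⟩ := Ideal.Quotient.mk_surjective y
      rw [hφ, Ideal.Quotient.eq, Ideal.mem_span_singleton] at hy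
      have h := (dvd_mul_right a b).trans hy
      exact (dvd_sub_right (dvd_mul_right a y)).1 h
    · rintro ⟨y, rfl⟩
      exact ⟨Ideal.Quotient.mk _ y, hφ y⟩
  · intro x
    obtain ⟨x, rfl⟩ := Ideal.Quotient.mk_surjective x
    simp only [Algebra.coe_lmul_eq_mul, LinearMap.mul_apply', ← map_mul, hφ]
    congr 1
    ring
  · intro x
    obtain ⟨x, rfl⟩ := Ideal.Quotient.mk_surjective x
    simp only [Algebra.coe_lmul_eq_mul, LinearMap.mul_apply', ← map_mul, hψ]

theorem nrm_one {Fq : Type} [Field Fq] (f : Polynomial Fq) : nrm 1 f = 1 := by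
  unfold nrm
  have : Subsingleton (Polynomial Fq ⧸ Ideal.span {(1 : Polynomial Fq)}) :=
    Ideal.Quotient.subsingleton_iff.2 (Ideal.span_singleton_one)
  rw [Subsingleton.elim (Ideal.Quotient.mk (Ideal.span {(1 : Polynomial Fq)}) f) 1, map_one]

theorem quadChar_eq {F : Type} [Field F] [Fintype F] (x : F) :
    quadChar x = quadraticChar F x := by
  rw [quadraticChar_apply]
  unfold quadChar quadraticCharFun
  have : (∃ y : F, y ^ 2 = x) ↔ IsSquare x := by
    rw [isSquare_iff_exists_sq]
    exact exists_congr fun y => eq_comm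
  simp only [this]

theorem isSquare_norm {F K : Type} [Field F] [Fintype F] [Field K] [Algebra F K]
    [FiniteDimensional F K] (h2 : Odd (Fintype.card F)) (x : K) (hx : x ≠ 0) :
    IsSquare (Algebra.norm F x) ↔ IsSquare x := by
  have : Finite K := Module.finite_of_finite F
  have := Fintype.ofFinite K
  have hF : ringChar F ≠ 2 := by
    intro h
    have := FiniteField.even_card_of_char_two h
    rw [Nat.odd_iff] at h2
    omega
  have hK : ringChar K ≠ 2 := by rwa [← Algebra.ringChar_eq F K]
  have hN : Algebra.norm F x ≠ 0 := by rwa [Algebra.norm_ne_zero_iff]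
  rw [FiniteField.isSquare_iff hF hN, FiniteField.isSquare_iff hK hx,
    ← (algebraMap F K).injective.eq_iff, map_pow, map_one,
    FiniteField.algebraMap_norm_eq_pow, ← pow_mul]
  have hK2 := FiniteField.odd_card_of_char_ne_two hK
  have hF2 := Nat.odd_iff.1 h2
  have hd : Nat.card F - 1 ∣ Nat.card K - 1 := by
    rw [Module.natCard_eq_pow_finrank (K := F) (V := K)]
    simpa using Nat.sub_dvd_pow_sub_pow (Nat.card F) 1 (Module.finrank F K)
  obtain ⟨c, hc⟩ := hd
  have hF1 : 1 < Nat.card F := Finite.one_lt_card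
  have : (Nat.card K - 1) / (Nat.card F - 1) * (Fintype.card F / 2) = Fintype.card K / 2 := by
    rw [hc, Nat.mul_div_cancel_left _ (by omega)]
    rw [Nat.card_eq_fintype_card] at *
    rw [Nat.card_eq_fintype_card] at *
    obtain ⟨m, hm⟩ := h2
    have h1 : Fintype.card F / 2 = m := by omega
    have h3 : Fintype.card F - 1 = 2 * m := by omega
    rw [h3, mul_assoc] at hc
    rw [h1, mul_comm]
    omega
  rw [this]

theorem legendre_eq {F : Type} [Field F] [Fintype F] (h2 : Odd (Fintype.card F))
    (f P : Polynomial F) (hP : Irreducible P) :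
    legendreSymbolPoly f P = quadraticChar F (nrm P f) := by
  have := fd_quot P hP.ne_zero
  have : (Ideal.span {P}).IsMaximal := PrincipalIdealRing.isMaximal_of_irreducible hP
  let _ : Field (Polynomial F ⧸ Ideal.span {P}) := Ideal.Quotient.field _
  have hdvd : P ∣ f ↔ Ideal.Quotient.mk (Ideal.span {P}) f = 0 := by
    rw [Ideal.Quotient.eq_zero_iff_mem, Ideal.mem_span_singleton]
  have hsq : (∃ z : Polynomial F, P ∣ (z ^ 2 - f)) ↔
      IsSquare (Ideal.Quotient.mk (Ideal.span {P}) f) := by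
    rw [isSquare_iff_exists_sq]
    constructor
    · rintro ⟨z, hz⟩
      refine ⟨Ideal.Quotient.mk _ z, ?_⟩
      rw [← map_pow, eq_comm, Ideal.Quotient.eq, Ideal.mem_span_singleton]
      exact hz
    · rintro ⟨z, hz⟩
      obtain ⟨z, rfl⟩ := Ideal.Quotient.mk_surjective z
      refine ⟨z, ?_⟩
      rwa [← map_pow, eq_comm, Ideal.Quotient.eq, Ideal.mem_span_singleton] at hz
  rw [← quadChar_eq]
  unfold legendreSymbolPoly quadChar
  by_cases h : P ∣ f
  · have : nrm P f = 0 := by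
      unfold nrm
      rw [hdvd.1 h, Algebra.norm_eq_zero_iff]
    simp [h, this]
  · have hx := mt hdvd.2 h
    have hne : nrm P f ≠ 0 := by
      unfold nrm
      rwa [Algebra.norm_ne_zero_iff]
    have h3 : (∃ y : F, y ^ 2 = nrm P f) ↔ IsSquare (nrm P f) := by
      rw [isSquare_iff_exists_sq]
      exact exists_congr fun y => eq_comm
    have h4 : IsSquare (nrm P f) ↔ IsSquare (Ideal.Quotient.mk (Ideal.span {P}) f) :=
      isSquare_norm h2 _ hx
    simp only [h, hne, if_false, hsq, h3, h4]

theorem multiset_eq {F : Type} [Field F] [Fintype F] (h2 : Odd (Fintype.card F))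
    (f : Polynomial F) (s : Multiset (Polynomial F)) (hs : ∀ P ∈ s, Irreducible P) :
    (s.map (fun P => legendreSymbolPoly f P)).prod = quadraticChar F (nrm s.prod f) := by
  induction s using Multiset.induction with
  | empty => simp [nrm_one]
  | cons P s ih =>
    have hP := hs P (Multiset.mem_cons_self P s)
    have hs' : ∀ Q ∈ s, Irreducible Q := fun Q hQ => hs Q (Multiset.mem_cons_of_mem hQ)
    have h0 : s.prod ≠ 0 := by
      rw [Ne, Multiset.prod_eq_zero_iff]
      exact fun h => (hs' 0 h).ne_zero rfl
    rw [Multiset.map_cons, Multiset.prod_cons, Multiset.prod_cons, ih hs',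
      nrm_mul _ _ _ hP.ne_zero h0, map_mul, legendre_eq h2 f P hP, mul_comm]

/-- **Jacobi symbol via resultant.** Let `q` be an odd prime power, `f ∈ F_q[T]`, and `g` of
degree `n ≥ 1` with leading coefficient `a_n`. Then
`(f/g) = ψ(a_n)^(max{deg f, 0}) · ψ(Res(g, f))`, where `ψ` is the quadratic character of
`F_q^×` (and `max{deg f, 0} = 0` when `f = 0`, matching `natDegree`). -/
theorem statement11 (q : ℕ) (hq : IsPrimePow q) (hodd : Odd q)
    (Fq : Type) [Field Fq] [Fintype Fq] (hcard : Fintype.card Fq = q)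
    (f g : Polynomial Fq) (hg : 1 ≤ g.natDegree) :
    jacobiSymbolPoly f g
      = quadChar g.leadingCoeff ^ f.natDegree * quadChar (presultant g f) := by
  subst hcard
  have hg0 : g ≠ 0 := by
    rintro rfl
    simp at hg
  have hl : g.leadingCoeff ≠ 0 := by simpa using hg0
  unfold jacobiSymbolPoly
  rw [multiset_eq hodd f _ (fun P hP => UniqueFactorizationMonoid.irreducible_of_normalized_factor P hP),
    UniqueFactorizationMonoid.prod_normalizedFactors_eq hg0]
  change _ = quadChar g.leadingCoeff ^ f.natDegree *
    quadChar (g.leadingCoeff ^ f.natDegree * nrm (normalize g) f)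
  rw [quadChar_eq, quadChar_eq, map_mul, map_pow, ← mul_assoc, ← mul_pow, ← sq,
    quadraticChar_sq_one hl, one_pow, one_mul]
end
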